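/- Let T be a 2-arc-strong semicomplete digraph on t ≥ 2 vertices and let H_1, ..., H_t be arbitrary digraphs. If the composition Q = T[H_1, ..., H_t] is not isomorphic to S4, then Q has a pair of arc-disjoint strong spanning subdigraphs. -/

import Mathlib

/-- A digraph (given by its arc relation) is strong (strongly connected). -/
def IsStrong {V : Type*} (A : V → V → Prop) : Prop :=
  ∀ x y : V, Relation.ReflTransGen A x y

/-- `A` has a pair of arc-disjoint strong spanning subdigraphs (a good decomposition). -/
def GoodDecomp {V : Type*} (A : V → V → Prop) : Prop :=
  ∃ A₁ A₂ : V → V → Prop,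
    (∀ x y, A₁ x y → A x y) ∧ (∀ x y, A₂ x y → A x y) ∧
    (∀ x y, ¬ (A₁ x y ∧ A₂ x y)) ∧ IsStrong A₁ ∧ IsStrong A₂

/-- Arc relation of the composition `T[H_1, ..., H_t]`. -/
def CompArc {t : ℕ} {Vt : Fin t → Type*} (T : Fin t → Fin t → Prop)
    (H : ∀ i, Vt i → Vt i → Prop) : (Σ i, Vt i) → (Σ i, Vt i) → Prop :=
  fun a b => T a.1 b.1 ∨ ∃ h : a.1 = b.1, H b.1 (h ▸ a.2) b.2


/-- The cyclic successor on `Fin n`. -/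
def finSucc {n : ℕ} (x : Fin n) : Fin n := ⟨(x.val + 1) % n, Nat.mod_lt _ x.pos⟩

def Semicomplete {V : Type*} (A : V → V → Prop) : Prop :=
  ∀ x y : V, x ≠ y → A x y ∨ A y x

/-- `A` is 2-arc-strong: it stays strong after deleting any set of at most one arc. -/
def TwoArcStrong {V : Type*} (A : V → V → Prop) : Prop :=
  ∀ X : Set (V × V), X.Subsingleton → IsStrong (fun x y => A x y ∧ (x, y) ∉ X)

/-- Digraph isomorphism. -/
def DIso {V W : Type*} (A : V → V → Prop) (B : W → W → Prop) : Prop :=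
  ∃ e : V ≃ W, ∀ x y, A x y ↔ B (e x) (e y)

/-- Arc relation of the directed cycle on `n` vertices. -/
def CycleArc (n : ℕ) : Fin n → Fin n → Prop := fun x y => y = finSucc x

/-- `T` (on `Fin t`) has a Hamiltonian cycle. -/
def HasHamCycle {t : ℕ} (T : Fin t → Fin t → Prop) : Prop :=
  ∃ e : Equiv.Perm (Fin t), ∀ i, T (e i) (e (finSucc i))

/-- Cartesian product of digraphs. -/
def CartProd {V W : Type*} (A : V → V → Prop) (B : W → W → Prop) :
    V × W → V × W → Prop :=
  fun p q => (A p.1 q.1 ∧ p.2 = q.2) ∨ (p.1 = q.1 ∧ B p.2 q.2)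

/-- Strong product of digraphs. -/
def StrongProd {V W : Type*} (A : V → V → Prop) (B : W → W → Prop) :
    V × W → V × W → Prop :=
  fun p q => (A p.1 q.1 ∧ p.2 = q.2) ∨ (p.1 = q.1 ∧ B p.2 q.2) ∨ (A p.1 q.1 ∧ B p.2 q.2)

/-- Lexicographic product of digraphs. -/
def LexProd {V W : Type*} (A : V → V → Prop) (B : W → W → Prop) :
    V × W → V × W → Prop :=
  fun p q => A p.1 q.1 ∨ (p.1 = q.1 ∧ B p.2 q.2)

/-- `k`-th Cartesian power of a digraph. -/
def CartPow {V : Type*} (A : V → V → Prop) (k : ℕ) :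
    (Fin k → V) → (Fin k → V) → Prop :=
  fun f g => ∃ i, A (f i) (g i) ∧ ∀ j, j ≠ i → f j = g j

/-- `A` has a collection of pairwise arc-disjoint directed cycles covering all vertices. -/
def HasCycleCover {V : Type*} (A : V → V → Prop) : Prop :=
  ∃ (k : ℕ) (m : Fin k → ℕ) (c : ∀ i : Fin k, Fin (m i) → V),
    (∀ i, 2 ≤ m i) ∧ (∀ i, Function.Injective (c i)) ∧
    (∀ i x, A (c i x) (c i (finSucc x))) ∧
    (∀ i j x y, c i x = c j y → c i (finSucc x) = c j (finSucc y) → i = j) ∧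
    (∀ v : V, ∃ i x, c i x = v)

/-- The digraph `C3[K2bar, K2bar, K2bar]`. -/
def Exc1 : Fin 3 × Fin 2 → Fin 3 × Fin 2 → Prop := fun p q => q.1 = finSucc p.1

/-- The digraph `C3[P2, K2bar, K2bar]`, the single arc of `P2` being `(0,0) → (0,1)`. -/
def Exc2 : Fin 3 × Fin 2 → Fin 3 × Fin 2 → Prop :=
  fun p q => q.1 = finSucc p.1 ∨ (p.1 = 0 ∧ q.1 = 0 ∧ p.2 = 0 ∧ q.2 = 1)

/-- Block index for `C3[K2bar, K2bar, K3bar]`. -/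
def blk : (Fin 2 ⊕ Fin 2 ⊕ Fin 3) → Fin 3 :=
  Sum.elim (fun _ => 0) (Sum.elim (fun _ => 1) (fun _ => 2))

/-- The digraph `C3[K2bar, K2bar, K3bar]`. -/
def Exc3 : (Fin 2 ⊕ Fin 2 ⊕ Fin 3) → (Fin 2 ⊕ Fin 2 ⊕ Fin 3) → Prop :=
  fun p q => blk q = finSucc (blk p)

/-- `S4`: the complete digraph on 4 vertices minus the directed 4-cycle `x → x+1`. -/
def S4Arc : Fin 4 → Fin 4 → Prop := fun x y => x ≠ y ∧ y ≠ finSucc x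

section

open Finset

/-- Total multiplicity of the arcs from `S` to `R`. -/
def arcCount {V : Type*} (m : V → V → ℕ) (S R : Finset V) : ℕ := ∑ x ∈ S, ∑ y ∈ R, m x y

/-- `A` restricted to `X` is strong, in terms of cuts. -/
def CutStrong {V : Type*} (A : V → V → Prop) (X : Finset V) : Prop :=
  ∀ S ⊆ X, S.Nonempty → S ≠ X → ∃ x ∈ S, ∃ y ∈ X, y ∉ S ∧ A x y

/-- Every cut of the multidigraph `m` on `X` has at least `k` arcs. -/
def CutAtLeast {V : Type*} [DecidableEq V] (k : ℕ) (m : V → V → ℕ) (X : Finset V) : Prop :=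
  ∀ S ⊆ X, S.Nonempty → S ≠ X → k ≤ arcCount m S (X \ S)

/-- The multidigraph `m` is semicomplete on `X`. -/
def SemiOn {V : Type*} (m : V → V → ℕ) (X : Finset V) : Prop :=
  ∀ x ∈ X, ∀ y ∈ X, x ≠ y → m x y ≠ 0 ∨ m y x ≠ 0

/-- The multidigraph `m` on `X` has a good decomposition. -/
def Decomposable {V : Type*} (m : V → V → ℕ) (X : Finset V) : Prop :=
  ∃ A B : V → V → Prop, (∀ x y, A x y → 1 ≤ m x y) ∧ (∀ x y, B x y → 1 ≤ m x y) ∧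
    (∀ x y, A x y → B x y → 2 ≤ m x y) ∧ CutStrong A X ∧ CutStrong B X

/-! ### Certified case analysis on few vertices

Sets of arcs on `Fin n` are encoded as natural numbers, bit `8 * x + y` standing for `x → y`. -/

/-- The encoded arc set `M` contains `x → y`. -/
def hasArc {n : ℕ} (M : ℕ) (x y : Fin n) : Bool := M.testBit (8 * x.val + y.val)

/-- The code of the single arc `x → y`. -/
def arcCode {n : ℕ} (x y : Fin n) : ℕ := 2 ^ (8 * x.val + y.val)

/-- The multiplicity of an arc present in the levels `L₁`, `L₂`. -/
def lowMult {n : ℕ} (L₁ L₂ : ℕ) (x y : Fin n) : ℕ :=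
  (hasArc L₁ x y).toNat + (hasArc L₂ x y).toNat

/-- `S` codes a vertex set and the arc `x → y` leaves it. -/
def crosses {n : ℕ} (S : ℕ) (x y : Fin n) : Bool := S.testBit x.val && !S.testBit y.val

/-- A decision tree on the multiplicities of arcs. -/
inductive CaseTree (n : ℕ) : Type
  | split (x y : Fin n) (more exact : CaseTree n)
  | cut (S : ℕ)
  | pair (x y : Fin n)
  | leaf (A : ℕ)

/-- Checks a decision tree: `L₁`, `L₂` are lower bounds, the arcs in `F` attain them, and the
arcs in `G` have multiplicity at most one. -/
def CaseTree.check {n : ℕ} (k G : ℕ) (goal : ℕ → ℕ → ℕ → ℕ → Bool) :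
    CaseTree n → ℕ → ℕ → ℕ → Bool
  | .split x y s t, L₁, L₂, F =>
    (bif hasArc L₁ x y then s.check k G goal L₁ (L₂ ||| arcCode x y) F
      else s.check k G goal (L₁ ||| arcCode x y) L₂ F) &&
      t.check k G goal L₁ L₂ (F ||| arcCode x y)
  | .cut S, L₁, L₂, F =>
    decide (S ≠ 0 ∧ S < 2 ^ n - 1 ∧
      (∀ x y : Fin n, crosses S x y = true → hasArc (F ||| (L₁ &&& G)) x y = true) ∧
      ∑ x : Fin n, ∑ y : Fin n, (if crosses S x y then lowMult L₁ L₂ x y else 0) < k)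
  | .pair x y, L₁, L₂, F =>
    decide (x ≠ y ∧ hasArc F x y = true ∧ hasArc F y x = true ∧
      lowMult L₁ L₂ x y = 0 ∧ lowMult L₁ L₂ y x = 0)
  | .leaf A, L₁, L₂, F => goal A L₁ L₂ (F ||| (L₁ &&& G))

/-- The multidigraph `m` satisfies the bounds coded by `L₁`, `L₂`, `F`. -/
def Meets {n : ℕ} (m : Fin n → Fin n → ℕ) (L₁ L₂ F : ℕ) : Prop :=
  ∀ x y, lowMult L₁ L₂ x y ≤ m x y ∧ (hasArc F x y = true → m x y ≤ lowMult L₁ L₂ x y)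

lemma hasArc_or {n : ℕ} (M N : ℕ) (x y : Fin n) :
    hasArc (M ||| N) x y = (hasArc M x y || hasArc N x y) := by
  simp [hasArc]

lemma hasArc_and {n : ℕ} (M N : ℕ) (x y : Fin n) :
    hasArc (M &&& N) x y = (hasArc M x y && hasArc N x y) := by
  simp [hasArc]

lemma hasArc_xor {n : ℕ} (M N : ℕ) (x y : Fin n) :
    hasArc (M ^^^ N) x y = (hasArc M x y ^^ hasArc N x y) := by
  simp [hasArc]

lemma hasArc_arcCode {n : ℕ} (hn : n ≤ 8) (a b x y : Fin n) :
    hasArc (arcCode a b) x y = decide (x = a ∧ y = b) := by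
  unfold hasArc arcCode
  rw [Nat.testBit_two_pow]
  have := x.2; have := y.2; have := a.2; have := b.2
  simp only [Fin.ext_iff, decide_eq_decide]
  omega

lemma exists_code {n : ℕ} (S : Finset (Fin n)) :
    ∃ s < 2 ^ n, ∀ x : Fin n, s.testBit x.val = decide (x ∈ S) := by
  refine ⟨Nat.ofBits fun x : Fin n => decide (x ∈ S), Nat.ofBits_lt_two_pow _, fun x => ?_⟩
  rw [Nat.testBit_ofBits_lt _ _ x.2]

lemma code_ne_zero {n s : ℕ} {S : Finset (Fin n)} (hS : S.Nonempty)
    (h : ∀ x : Fin n, s.testBit x.val = decide (x ∈ S)) : s ≠ 0 := by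
  rintro rfl
  obtain ⟨x, hx⟩ := hS
  simpa [hx] using h x

lemma code_ne_full {n s : ℕ} {S : Finset (Fin n)} (hS : S ≠ univ)
    (h : ∀ x : Fin n, s.testBit x.val = decide (x ∈ S)) : s ≠ 2 ^ n - 1 := by
  rintro rfl
  refine hS (Finset.eq_univ_iff_forall.2 fun x => ?_)
  simpa [Nat.testBit_two_pow_sub_one] using h x

/-- The encoded arc set is strong on `Fin n`. -/
def strongCode (n M : ℕ) : Bool :=
  (List.range (2 ^ n)).all fun s => s == 0 || s == 2 ^ n - 1 ||
    (List.finRange n).any fun x => s.testBit x.val &&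
      (List.finRange n).any fun y => !s.testBit y.val && hasArc M x y

lemma cutStrong_of_strongCode {n M : ℕ} (h : strongCode n M = true) :
    CutStrong (fun x y : Fin n => hasArc M x y = true) univ := by
  intro S _ hne hnu
  obtain ⟨s, hs, hS⟩ := exists_code S
  have := List.all_eq_true.1 h s (List.mem_range.2 hs)
  simp only [Bool.or_eq_true, beq_iff_eq, code_ne_zero hne hS, code_ne_full hnu hS, false_or,
    List.any_eq_true, Bool.and_eq_true, List.mem_finRange, true_and, hS, Bool.not_eq_true',
    decide_eq_true_eq, decide_eq_false_iff_not] at this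
  obtain ⟨x, hx, y, hy, hxy⟩ := this
  exact ⟨x, hx, y, mem_univ _, hy, hxy⟩

/-- Whether the arc set `A` and its complement in the multidigraph are both strong. -/
def splitsInto (n A L₁ L₂ : ℕ) : Bool :=
  A &&& L₁ == A && strongCode n A && strongCode n ((L₁ ^^^ A) ||| L₂)

lemma decomposable_of_splitsInto {n A L₁ L₂ F : ℕ} {m : Fin n → Fin n → ℕ} (hm : Meets m L₁ L₂ F)
    (h : splitsInto n A L₁ L₂ = true) : Decomposable m univ := by
  simp only [splitsInto, Bool.and_eq_true, beq_iff_eq] at h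
  obtain ⟨⟨hA, hA'⟩, hB⟩ := h
  have sub : ∀ x y : Fin n, hasArc A x y = true → hasArc L₁ x y = true := by
    intro x y hxy
    rw [← hA, hasArc_and] at hxy
    simp_all
  refine ⟨_, _, ?_, ?_, ?_, cutStrong_of_strongCode hA', cutStrong_of_strongCode hB⟩
  · intro x y hxy
    have h1 := (hm x y).1
    have := sub x y hxy
    simp only [lowMult, this] at h1
    simp at h1; omega
  · intro x y hxy
    have h1 := (hm x y).1
    have := sub x y
    simp only [lowMult] at h1
    simp only [hasArc_or, hasArc_xor] at hxy
    revert h1 hxy this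
    cases hasArc L₁ x y <;> cases hasArc L₂ x y <;> cases hasArc A x y <;> simp <;> omega
  · intro x y hx hxy
    have h1 := (hm x y).1
    have := sub x y hx
    simp only [lowMult] at h1
    simp only [hasArc_or, hasArc_xor] at hxy
    revert h1 hxy this hx
    cases hasArc L₁ x y <;> cases hasArc L₂ x y <;> cases hasArc A x y <;> simp

theorem CaseTree.exists_leaf {n : ℕ} (hn : n ≤ 8) {k G : ℕ} {goal : ℕ → ℕ → ℕ → ℕ → Bool}
    {m : Fin n → Fin n → ℕ} (hsemi : SemiOn m univ) (hcut : CutAtLeast k m univ)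
    (hG : ∀ x y, hasArc G x y = true → m x y ≤ 1) (c : CaseTree n) :
    ∀ L₁ L₂ F, Meets m L₁ L₂ F → c.check k G goal L₁ L₂ F = true →
      ∃ A L₁ L₂ F, Meets m L₁ L₂ F ∧ goal A L₁ L₂ F = true := by
  have full : ∀ {L₁ L₂ F}, Meets m L₁ L₂ F → Meets m L₁ L₂ (F ||| (L₁ &&& G)) := by
    intro L₁ L₂ F hm x y
    refine ⟨(hm x y).1, fun h => ?_⟩
    simp only [hasArc_or, hasArc_and, Bool.or_eq_true, Bool.and_eq_true] at h
    rcases h with h | ⟨h, h'⟩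
    · exact (hm x y).2 h
    · have := hG x y h'
      simp only [lowMult, h]
      simp; omega
  induction c with
  | split a b s t ihs iht =>
    intro L₁ L₂ F hm h
    simp only [check, Bool.and_eq_true] at h
    obtain ⟨h1, h2⟩ := h
    by_cases hab : m a b ≤ lowMult L₁ L₂ a b
    · refine iht _ _ _ (fun x y => ⟨(hm x y).1, fun hF => ?_⟩) h2
      simp only [hasArc_or, hasArc_arcCode hn, Bool.or_eq_true, decide_eq_true_eq] at hF
      rcases hF with hF | ⟨rfl, rfl⟩
      · exact (hm x y).2 hF
      · exact hab
    · cases hL : hasArc L₁ a b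
      · rw [hL] at h1
        refine ihs _ _ _ (fun x y => ?_) h1
        have := hm x y
        by_cases hxy : x = a ∧ y = b
        · obtain ⟨rfl, rfl⟩ := hxy
          simp only [lowMult, hasArc_or, hasArc_arcCode hn, hL] at hab this ⊢
          simp at hab this ⊢
          exact ⟨by omega, fun h => absurd (this.2 h) (by omega)⟩
        · simp only [lowMult, hasArc_or, hasArc_arcCode hn, hxy] at this ⊢
          simpa using this
      · rw [hL] at h1
        refine ihs _ _ _ (fun x y => ?_) h1
        have := hm x y
        by_cases hxy : x = a ∧ y = b
        · obtain ⟨rfl, rfl⟩ := hxy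
          simp only [lowMult, hasArc_or, hasArc_arcCode hn, hL] at hab this ⊢
          simp at hab this ⊢
          exact ⟨by omega, fun h => absurd (this.2 h) (by omega)⟩
        · simp only [lowMult, hasArc_or, hasArc_arcCode hn, hxy] at this ⊢
          simpa using this
  | cut S =>
    intro L₁ L₂ F hm h
    simp only [check, decide_eq_true_eq] at h
    obtain ⟨h0, h1, hU, hlt⟩ := h
    exfalso
    let R : Finset (Fin n) := univ.filter fun x => S.testBit x.val
    have hR : ∀ x : Fin n, x ∈ R ↔ S.testBit x.val = true := by simp [R]
    have hSn : S < 2 ^ n := by omega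
    have := hcut R (subset_univ _) ?_ ?_
    · refine absurd hlt (not_lt.2 (this.trans ?_))
      unfold arcCount
      have e : ∑ x ∈ R, ∑ y ∈ univ \ R, m x y =
          ∑ x : Fin n, ∑ y : Fin n, if crosses S x y then m x y else 0 := by
        rw [← Finset.sum_subset (subset_univ R)]
        · refine Finset.sum_congr rfl fun x hx => ?_
          rw [← Finset.sum_subset (subset_univ (univ \ R))]
          · refine Finset.sum_congr rfl fun y hy => ?_
            have : crosses S x y = true := by
              simp only [mem_sdiff, hR, mem_univ, true_and] at hx hy
              simp [crosses, hx, hy]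
            simp [this]
          · intro y _ hy
            have : crosses S x y = false := by
              simp only [mem_sdiff, hR, mem_univ, true_and, not_not] at hy
              simp [crosses, hy]
            simp [this]
        · intro x _ hx
          have : S.testBit x.val = false := by simpa [hR] using hx
          simp [crosses, this]
      rw [e]
      refine Finset.sum_le_sum fun x _ => Finset.sum_le_sum fun y _ => ?_
      split_ifs with hc
      · exact (full hm x y).2 (hU x y hc)
      · exact le_rfl
    · by_contra hne
      rw [Finset.not_nonempty_iff_eq_empty] at hne
      refine h0 (Nat.eq_of_testBit_eq fun i => ?_)
      by_cases hi : i < n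
      · have : (⟨i, hi⟩ : Fin n) ∉ R := by simp [hne]
        rw [hR] at this
        simpa using this
      · rw [Nat.testBit_lt_two_pow (hSn.trans_le (Nat.pow_le_pow_right (by omega) (not_lt.1 hi)))]
        simp
    · intro hu
      refine absurd h1 (not_lt.2 (le_of_eq ?_))
      refine (Nat.eq_of_testBit_eq fun i => ?_).symm
      rw [Nat.testBit_two_pow_sub_one]
      by_cases hi : i < n
      · have : (⟨i, hi⟩ : Fin n) ∈ R := by simp [hu]
        rw [hR] at this
        simpa [hi] using this
      · rw [Nat.testBit_lt_two_pow (hSn.trans_le (Nat.pow_le_pow_right (by omega) (not_lt.1 hi)))]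
        simp [hi]
  | pair x y =>
    intro L₁ L₂ F hm h
    simp only [check, decide_eq_true_eq] at h
    obtain ⟨hne, h1, h2, h3, h4⟩ := h
    have := (hm x y).2 h1
    have := (hm y x).2 h2
    rcases hsemi x (mem_univ _) y (mem_univ _) hne with h | h <;> omega
  | leaf A =>
    intro L₁ L₂ F hm h
    exact ⟨A, L₁, L₂, _, full hm, h⟩

/-- Cases for five vertices, four of which span a given strong tournament. -/
def fiveVertexTree : CaseTree 5 :=
  .split 0 1 (.split 0 2 (.split 0 3 (.split 0 4 (.split 3 0 (.split 4 0 (.leaf 8607762436)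
  (.split 4 1 (.split 1 0 (.leaf 8607762436) (.split 2 0 (.leaf 8607762436) (.split 3 0 (.leaf
  8607762436) (.cut 30)))) (.split 4 2 (.split 1 0 (.leaf 17197172754) (.split 2 0 (.leaf
  8607762436) (.split 3 0 (.leaf 8607762436) (.cut 30)))) (.split 4 3 (.split 1 0 (.leaf
  8858894596) (.split 2 0 (.leaf 8858436616) (.split 3 0 (.leaf 8607762436) (.cut 30)))) (.cut
  16))))) (.split 3 1 (.split 1 0 (.split 1 0 (.split 4 0 (.leaf 8858894596) (.split 4 1 (.leaf
  8858894596) (.split 4 2 (.leaf 17213948176) (.split 4 3 (.leaf 8858894596) (.cut 16)))))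
  (.split 2 0 (.split 4 0 (.leaf 8858894596) (.split 4 1 (.leaf 8858894596) (.split 4 2 (.leaf
  8858894596) (.split 4 3 (.leaf 8858894596) (.cut 16))))) (.split 4 0 (.leaf 8858894596) (.cut
  30)))) (.split 2 0 (.split 2 0 (.split 4 0 (.leaf 4563470342) (.split 4 1 (.split 1 2 (.leaf
  8858436616) (.split 3 2 (.leaf 8858436616) (.split 4 2 (.leaf 17448372226) (.cut 26))))
  (.split 4 2 (.leaf 17448372226) (.split 4 3 (.split 1 2 (.leaf 8858436616) (.split 3 2 (.leaf
  8858436616) (.cut 26))) (.cut 16))))) (.split 4 0 (.leaf 4563929094) (.cut 30))) (.split 4 0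
  (.split 4 0 (.leaf 4563929094) (.cut 30)) (.cut 30)))) (.split 3 2 (.split 1 0 (.split 1 0
  (.split 4 0 (.leaf 8858894596) (.split 4 1 (.leaf 8858894596) (.split 4 2 (.split 2 0 (.leaf
  8858894596) (.split 2 1 (.leaf 8858894596) (.cut 28))) (.split 4 3 (.split 2 0 (.leaf
  8858894596) (.split 2 1 (.leaf 8858894596) (.cut 28))) (.cut 16))))) (.split 2 0 (.split 4 0
  (.leaf 8858894596) (.split 4 1 (.leaf 8858894596) (.split 4 2 (.leaf 8858894596) (.split 4 3
  (.leaf 8858894596) (.cut 16))))) (.split 4 0 (.leaf 8858894596) (.cut 30)))) (.split 2 0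
  (.split 2 0 (.split 4 0 (.leaf 8858436616) (.split 4 1 (.leaf 8858436616) (.split 4 2 (.leaf
  8858436616) (.split 4 3 (.leaf 8858436616) (.cut 16))))) (.split 4 0 (.leaf 8858436616) (.cut
  30))) (.split 4 0 (.split 4 0 (.leaf 4563929094) (.cut 30)) (.cut 30)))) (.split 3 4 (.split 4
  0 (.split 1 0 (.leaf 8858894596) (.split 2 0 (.leaf 8858436616) (.split 4 0 (.leaf 4563929094)
  (.cut 30)))) (.split 4 1 (.split 1 0 (.split 1 0 (.leaf 8858894596) (.split 2 0 (.leaf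
  8858894596) (.cut 30))) (.split 2 0 (.split 2 0 (.split 1 2 (.leaf 8858436616) (.split 4 2
  (.leaf 8858436616) (.cut 26))) (.cut 30)) (.cut 30))) (.split 4 2 (.split 2 0 (.split 1 0
  (.leaf 8858894596) (.split 2 0 (.leaf 8858436616) (.cut 30))) (.split 2 1 (.split 1 0 (.split
  1 0 (.leaf 8858894596) (.cut 30)) (.cut 30)) (.cut 28))) (.cut 24)))) (.cut 8))))) (.split 4 0
  (.split 3 0 (.leaf 8607762436) (.split 3 1 (.split 1 0 (.leaf 8858894596) (.split 2 0 (.leaf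
  4563929094) (.split 4 0 (.leaf 4563929094) (.cut 30)))) (.split 3 2 (.split 1 0 (.leaf
  8858894596) (.split 2 0 (.leaf 8858436616) (.split 4 0 (.leaf 4563929094) (.cut 30)))) (.split
  3 4 (.split 1 0 (.leaf 8858894596) (.split 2 0 (.leaf 8858436616) (.split 4 0 (.leaf
  4563929094) (.cut 30)))) (.cut 8))))) (.pair 0 4))) (.split 3 0 (.split 0 4 (.split 4 0 (.leaf
  8607762436) (.split 4 1 (.split 1 0 (.leaf 8858894596) (.split 2 0 (.leaf 8607762436) (.split
  3 0 (.leaf 8607762436) (.cut 30)))) (.split 4 2 (.split 1 0 (.leaf 17197171730) (.split 2 0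
  (.leaf 8607762436) (.split 3 0 (.leaf 8607762436) (.cut 30)))) (.split 4 3 (.split 1 0 (.leaf
  8858894596) (.split 2 0 (.leaf 34377566214) (.split 3 0 (.leaf 8607762436) (.cut 30)))) (.cut
  16))))) (.split 4 0 (.leaf 8607762436) (.pair 0 4))) (.pair 0 3))) (.split 2 0 (.split 0 3
  (.split 0 4 (.split 1 2 (.split 3 0 (.split 4 0 (.leaf 8858436616) (.split 4 1 (.leaf
  8858436616) (.split 4 2 (.leaf 8858436616) (.split 4 3 (.leaf 8858436616) (.cut 16)))))
  (.split 3 1 (.split 1 0 (.split 4 0 (.leaf 8858436616) (.split 4 1 (.leaf 8858436616) (.split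
  4 2 (.leaf 8858436616) (.split 4 3 (.leaf 8858436616) (.cut 16))))) (.split 2 0 (.split 4 0
  (.leaf 8858436616) (.split 4 1 (.leaf 8858436616) (.split 4 2 (.leaf 8858436616) (.split 4 3
  (.leaf 8858436616) (.cut 16))))) (.split 4 0 (.leaf 8858436616) (.cut 30)))) (.split 3 2
  (.split 1 0 (.split 4 0 (.leaf 8858436616) (.split 4 1 (.leaf 8858436616) (.split 4 2 (.leaf
  17448372226) (.split 4 3 (.leaf 34426914834) (.cut 16))))) (.split 2 0 (.split 4 0 (.leaf
  8858436616) (.split 4 1 (.leaf 8858436616) (.split 4 2 (.leaf 8858436616) (.split 4 3 (.leaf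
  8858436616) (.cut 16))))) (.split 4 0 (.leaf 8858436616) (.cut 30)))) (.split 3 4 (.split 4 0
  (.leaf 8858436616) (.split 4 1 (.split 1 0 (.leaf 8858436616) (.split 2 0 (.leaf 8858436616)
  (.cut 30))) (.split 4 2 (.split 1 0 (.leaf 17448372226) (.split 2 0 (.leaf 8858436616) (.cut
  30))) (.cut 24)))) (.cut 8))))) (.split 3 2 (.split 4 0 (.leaf 8858436616) (.split 4 1 (.split
  1 0 (.leaf 8858436616) (.split 2 0 (.leaf 8858436616) (.split 3 0 (.leaf 8858436616) (.cut
  30)))) (.split 4 2 (.split 1 0 (.leaf 17448372226) (.split 2 0 (.leaf 8858436616) (.split 3 0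
  (.leaf 8858436616) (.cut 30)))) (.split 4 3 (.split 1 0 (.leaf 34426914834) (.split 2 0 (.leaf
  8858436616) (.split 3 0 (.leaf 8858436616) (.cut 30)))) (.cut 16))))) (.split 4 2 (.split 3 0
  (.leaf 8858436616) (.split 3 1 (.split 1 0 (.leaf 8858436616) (.split 2 0 (.leaf 17448372226)
  (.split 4 0 (.leaf 17448372226) (.cut 30)))) (.split 3 4 (.split 1 0 (.leaf 17448372226)
  (.split 2 0 (.leaf 8858436616) (.split 4 0 (.leaf 8858436616) (.cut 30)))) (.cut 8)))) (.cut
  27)))) (.split 4 0 (.split 1 2 (.split 3 0 (.leaf 8858436616) (.split 3 1 (.leaf 8858436616)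
  (.split 3 2 (.leaf 8858436616) (.split 3 4 (.leaf 8858436616) (.cut 8))))) (.split 3 2 (.leaf
  8858436616) (.split 4 2 (.split 3 0 (.leaf 26038306824) (.split 3 1 (.leaf 17448372226)
  (.split 3 4 (.leaf 8858436616) (.cut 8)))) (.cut 27)))) (.pair 0 4))) (.split 3 0 (.split 0 4
  (.split 1 2 (.split 4 0 (.leaf 4563928066) (.split 4 1 (.leaf 8607237136) (.split 4 2 (.leaf
  17448372226) (.split 4 3 (.leaf 34377565186) (.cut 16))))) (.split 3 2 (.split 4 0 (.leaf
  4563928066) (.split 4 1 (.leaf 8607237136) (.split 4 2 (.leaf 17448372226) (.split 4 3 (.leaf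
  8607237136) (.cut 16))))) (.split 4 2 (.leaf 17448372226) (.cut 27)))) (.split 4 0 (.split 0 1
  (.split 1 2 (.leaf 4563928066) (.split 3 2 (.leaf 4563928066) (.split 4 2 (.leaf 17448372226)
  (.cut 27)))) (.cut 1)) (.pair 0 4))) (.pair 0 3))) (.pair 0 2))) (.split 1 0 (.split 0 2
  (.split 0 3 (.split 0 4 (.split 2 1 (.split 3 0 (.split 4 0 (.leaf 8607237136) (.split 4 1
  (.leaf 8858894596) (.split 4 2 (.leaf 8858894596) (.split 4 3 (.leaf 34376648724) (.cut
  16))))) (.split 3 1 (.split 1 0 (.split 4 0 (.leaf 8858894596) (.split 4 1 (.leaf 8858894596)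
  (.split 4 2 (.leaf 8858894596) (.split 4 3 (.leaf 8858894596) (.cut 16))))) (.split 2 0
  (.split 4 0 (.leaf 8858436616) (.split 4 1 (.leaf 8858436616) (.split 4 2 (.leaf 8858436616)
  (.split 4 3 (.leaf 8858436616) (.cut 16))))) (.split 4 0 (.leaf 8858894596) (.cut 30))))
  (.split 3 2 (.split 1 0 (.split 4 0 (.leaf 8858894596) (.split 4 1 (.leaf 8858894596) (.split
  4 2 (.leaf 8858894596) (.split 4 3 (.leaf 8858894596) (.cut 16))))) (.split 2 0 (.split 4 0
  (.leaf 8858436616) (.split 4 1 (.leaf 8858436616) (.split 4 2 (.leaf 8858436616) (.split 4 3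
  (.leaf 8858436616) (.cut 16))))) (.split 4 0 (.leaf 8858894596) (.cut 30)))) (.split 3 4
  (.split 4 0 (.leaf 4563535876) (.split 4 1 (.split 1 0 (.leaf 8858894596) (.split 2 0 (.leaf
  8858436616) (.cut 30))) (.split 4 2 (.split 1 0 (.leaf 8858894596) (.split 2 0 (.leaf
  8858436616) (.cut 30))) (.cut 24)))) (.cut 8))))) (.split 3 1 (.split 4 0 (.leaf 8858894596)
  (.split 4 1 (.split 1 0 (.leaf 8858894596) (.split 2 0 (.leaf 8858436616) (.split 3 0 (.leaf
  8858894596) (.cut 30)))) (.split 4 2 (.split 1 0 (.leaf 17213948176) (.split 2 0 (.leaf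
  8858436616) (.split 3 0 (.leaf 8607762436) (.cut 30)))) (.split 4 3 (.split 1 0 (.leaf
  8858894596) (.split 2 0 (.leaf 8858436616) (.split 3 0 (.leaf 8858894596) (.cut 30)))) (.cut
  16))))) (.split 4 1 (.split 3 0 (.leaf 8858894596) (.split 3 2 (.split 1 0 (.leaf 8858894596)
  (.split 2 0 (.leaf 8858436616) (.split 4 0 (.leaf 8858894596) (.cut 30)))) (.split 3 4 (.split
  1 0 (.leaf 8858894596) (.split 2 0 (.leaf 8858436616) (.split 4 0 (.leaf 8858894596) (.cut
  30)))) (.cut 8)))) (.cut 29)))) (.split 4 0 (.split 2 1 (.split 3 0 (.leaf 4312926212) (.split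
  3 1 (.leaf 8858894596) (.split 3 2 (.leaf 8858894596) (.split 3 4 (.leaf 4563535876) (.cut
  8))))) (.split 3 1 (.leaf 8858894596) (.split 4 1 (.split 3 0 (.leaf 8607762436) (.split 3 2
  (.leaf 8858894596) (.split 3 4 (.leaf 8858894596) (.cut 8)))) (.cut 29)))) (.pair 0 4)))
  (.split 3 0 (.split 0 4 (.split 2 1 (.split 4 0 (.leaf 8607237136) (.split 4 1 (.leaf
  8858894596) (.split 4 2 (.leaf 8858894596) (.split 4 3 (.leaf 34377697284) (.cut 16)))))
  (.split 3 1 (.split 4 0 (.leaf 8607763472) (.split 4 1 (.leaf 8858894596) (.split 4 2 (.leaf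
  8607762436) (.split 4 3 (.leaf 8858894596) (.cut 16))))) (.split 4 1 (.leaf 8858894596) (.cut
  29)))) (.split 4 0 (.split 0 2 (.split 2 1 (.leaf 8858894596) (.split 3 1 (.leaf 8607762436)
  (.split 4 1 (.leaf 8858894596) (.cut 29)))) (.cut 1)) (.pair 0 4))) (.pair 0 3))) (.split 2 0
  (.split 0 3 (.split 0 4 (.split 1 2 (.split 2 1 (.split 3 0 (.split 4 0 (.split 3 1 (.leaf
  8607237136) (.split 3 2 (.leaf 8607237136) (.split 4 1 (.leaf 8858436616) (.split 4 2 (.leaf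
  8858436616) (.cut 25))))) (.split 4 1 (.leaf 8858436616) (.split 4 2 (.leaf 8858436616)
  (.split 4 3 (.split 3 1 (.leaf 8858436616) (.split 3 2 (.leaf 8858436616) (.cut 25))) (.cut
  16))))) (.split 3 1 (.split 4 0 (.leaf 4329571336) (.split 4 1 (.leaf 8858436616) (.split 4 2
  (.leaf 8858436616) (.split 4 3 (.leaf 8858436616) (.cut 16))))) (.split 3 2 (.split 4 0 (.leaf
  4363257864) (.split 4 1 (.leaf 8858436616) (.split 4 2 (.leaf 8858436616) (.split 4 3 (.leaf
  8858436616) (.cut 16))))) (.split 3 4 (.split 4 1 (.leaf 8858436616) (.split 4 2 (.leaf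
  8858436616) (.cut 25))) (.cut 8))))) (.split 3 1 (.split 4 0 (.leaf 4329571336) (.split 4 1
  (.leaf 8858436616) (.split 4 2 (.leaf 8858436616) (.split 4 3 (.leaf 8858436616) (.cut 16)))))
  (.split 4 1 (.split 3 0 (.leaf 8858436616) (.split 3 2 (.leaf 8858436616) (.split 3 4 (.leaf
  8858436616) (.cut 8)))) (.cut 29)))) (.split 3 2 (.split 2 1 (.split 4 0 (.leaf 4363257864)
  (.split 4 1 (.leaf 8858436616) (.split 4 2 (.leaf 8858436616) (.split 4 3 (.leaf 8858436616)
  (.cut 16))))) (.split 3 1 (.split 4 0 (.leaf 4329571336) (.split 4 1 (.leaf 8858436616)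
  (.split 4 2 (.leaf 8858436616) (.split 4 3 (.leaf 8858436616) (.cut 16))))) (.split 4 1 (.leaf
  8858436616) (.cut 29)))) (.split 4 2 (.split 3 0 (.split 2 1 (.leaf 8858436616) (.split 3 1
  (.leaf 8858436616) (.split 4 1 (.leaf 8858436616) (.cut 29)))) (.split 3 1 (.leaf 8858436616)
  (.split 3 4 (.split 2 1 (.leaf 8858436616) (.split 4 1 (.leaf 8858436616) (.cut 29))) (.cut
  8)))) (.cut 27)))) (.split 4 0 (.split 0 3 (.split 3 1 (.split 1 2 (.leaf 8858436616) (.split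
  3 2 (.leaf 8858436616) (.split 4 2 (.leaf 4329571336) (.cut 27)))) (.split 3 2 (.split 2 1
  (.leaf 8858436616) (.split 4 1 (.leaf 8858436616) (.cut 29))) (.split 3 4 (.split 4 1 (.split
  1 2 (.leaf 8858436616) (.split 4 2 (.leaf 8858436616) (.cut 27))) (.split 4 2 (.split 2 1
  (.leaf 8858436616) (.cut 29)) (.cut 25))) (.cut 9)))) (.cut 1)) (.pair 0 4))) (.split 3 0
  (.split 0 4 (.split 0 4 (.split 4 1 (.split 1 2 (.leaf 8607237136) (.split 3 2 (.leaf
  8607237136) (.split 4 2 (.leaf 8607237136) (.cut 27)))) (.split 4 2 (.split 2 1 (.leaf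
  8607237136) (.split 3 1 (.leaf 17213948176) (.cut 29))) (.split 4 3 (.split 3 1 (.split 1 2
  (.leaf 8607237136) (.split 3 2 (.leaf 8607237136) (.cut 27))) (.split 3 2 (.split 2 1 (.leaf
  8607237136) (.cut 29)) (.cut 25))) (.cut 17)))) (.cut 1)) (.cut 1)) (.pair 0 3))) (.pair 0
  2))) (.pair 0 1))

/-- Cases for a strong semicomplete multidigraph on four vertices. -/
def fourCycleTree : CaseTree 4 :=
  .split 0 1 (.split 0 2 (.split 0 3 (.split 1 2 (.split 1 3 (.split 2 3 (.split 3 0 (.leaf 228)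
  (.split 3 1 (.split 1 0 (.leaf 225) (.split 2 0 (.leaf 114) (.cut 14))) (.split 3 2 (.split 2
  0 (.leaf 180) (.split 2 1 (.split 1 0 (.leaf 177) (.cut 14)) (.cut 12))) (.cut 8)))) (.split 3
  2 (.split 2 0 (.leaf 180) (.split 2 1 (.split 1 0 (.leaf 177) (.split 3 0 (.leaf 99) (.cut
  14))) (.cut 4))) (.pair 2 3))) (.split 3 1 (.split 2 3 (.split 1 0 (.leaf 225) (.split 2 0
  (.leaf 114) (.split 3 0 (.leaf 147) (.cut 14)))) (.split 3 2 (.split 2 0 (.leaf 156) (.split 2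
  1 (.split 1 0 (.leaf 108) (.cut 6)) (.cut 4))) (.pair 2 3))) (.pair 1 3))) (.split 2 1 (.split
  1 3 (.split 2 3 (.split 3 0 (.leaf 216) (.split 3 1 (.split 1 0 (.leaf 120) (.split 3 2
  (.split 2 0 (.leaf 210) (.cut 14)) (.cut 10))) (.split 3 2 (.split 1 0 (.leaf 177) (.split 2 0
  (.leaf 210) (.cut 14))) (.cut 8)))) (.split 3 2 (.split 1 0 (.leaf 177) (.split 2 0 (.leaf
  210) (.split 3 0 (.leaf 99) (.cut 14)))) (.pair 2 3))) (.split 3 1 (.split 1 0 (.split 2 3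
  (.leaf 120) (.split 3 2 (.leaf 108) (.pair 2 3))) (.cut 2)) (.pair 1 3))) (.pair 1 2)))
  (.split 3 0 (.split 1 2 (.split 1 3 (.split 2 3 (.leaf 228) (.split 3 2 (.split 2 0 (.leaf 45)
  (.split 2 1 (.leaf 99) (.cut 4))) (.pair 2 3))) (.split 3 1 (.split 2 3 (.leaf 147) (.cut 7))
  (.pair 1 3))) (.split 2 1 (.split 1 3 (.split 2 3 (.leaf 216) (.split 3 2 (.leaf 99) (.pair 2
  3))) (.split 3 1 (.split 1 0 (.split 2 3 (.leaf 30) (.cut 7)) (.cut 2)) (.pair 1 3))) (.pair 1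
  2))) (.pair 0 3))) (.split 2 0 (.split 0 3 (.split 1 2 (.split 1 3 (.split 2 3 (.split 3 0
  (.leaf 57) (.split 3 1 (.leaf 114) (.split 3 2 (.leaf 180) (.cut 8)))) (.split 3 2 (.leaf 180)
  (.pair 2 3))) (.split 3 1 (.split 2 3 (.leaf 114) (.split 3 2 (.leaf 156) (.pair 2 3))) (.pair
  1 3))) (.split 2 1 (.split 3 2 (.split 1 3 (.leaf 210) (.split 3 1 (.split 1 0 (.leaf 27)
  (.cut 2)) (.pair 1 3))) (.cut 11)) (.pair 1 2))) (.split 3 0 (.split 1 2 (.split 1 3 (.split 2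
  3 (.leaf 57) (.split 3 2 (.leaf 45) (.pair 2 3))) (.split 3 1 (.split 2 3 (.leaf 78) (.cut 7))
  (.pair 1 3))) (.split 2 1 (.split 1 3 (.split 3 2 (.leaf 75) (.cut 11)) (.cut 3)) (.pair 1
  2))) (.pair 0 3))) (.pair 0 2))) (.split 1 0 (.split 0 2 (.split 0 3 (.split 1 2 (.split 1 3
  (.split 2 3 (.split 2 1 (.split 3 0 (.leaf 54) (.split 3 1 (.leaf 120) (.split 3 2 (.leaf 177)
  (.cut 8)))) (.split 3 1 (.leaf 225) (.cut 13))) (.split 3 2 (.split 2 0 (.split 2 1 (.leaf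
  177) (.split 3 1 (.leaf 39) (.cut 13))) (.split 2 1 (.leaf 177) (.cut 4))) (.pair 2 3)))
  (.split 3 1 (.split 2 3 (.leaf 225) (.split 3 2 (.split 2 0 (.leaf 39) (.split 2 1 (.leaf 108)
  (.cut 4))) (.pair 2 3))) (.pair 1 3))) (.split 2 1 (.split 1 3 (.split 2 3 (.split 3 0 (.leaf
  54) (.split 3 1 (.leaf 120) (.split 3 2 (.leaf 177) (.cut 8)))) (.split 3 2 (.leaf 177) (.pair
  2 3))) (.split 3 1 (.split 2 3 (.leaf 120) (.split 3 2 (.leaf 108) (.pair 2 3))) (.pair 1 3)))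
  (.pair 1 2))) (.split 3 0 (.split 1 2 (.split 1 3 (.split 2 3 (.split 2 1 (.leaf 54) (.split 3
  1 (.leaf 135) (.cut 13))) (.split 3 2 (.split 2 1 (.leaf 141) (.cut 5)) (.pair 2 3))) (.split
  3 1 (.split 2 3 (.leaf 135) (.cut 7)) (.pair 1 3))) (.split 2 1 (.split 1 3 (.split 2 3 (.leaf
  54) (.split 3 2 (.leaf 141) (.pair 2 3))) (.split 3 1 (.split 2 3 (.leaf 30) (.cut 7)) (.pair
  1 3))) (.pair 1 2))) (.pair 0 3))) (.split 2 0 (.split 0 3 (.split 1 2 (.split 1 3 (.split 2 3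
  (.split 3 1 (.leaf 201) (.split 3 2 (.split 2 1 (.leaf 198) (.cut 13)) (.cut 9))) (.split 3 2
  (.split 2 1 (.leaf 198) (.split 3 1 (.leaf 39) (.cut 13))) (.pair 2 3))) (.split 3 1 (.split 2
  3 (.leaf 201) (.split 3 2 (.leaf 39) (.pair 2 3))) (.pair 1 3))) (.split 2 1 (.split 3 2
  (.split 1 3 (.leaf 198) (.split 3 1 (.leaf 27) (.pair 1 3))) (.cut 11)) (.pair 1 2))) (.cut
  1)) (.pair 0 2))) (.pair 0 1))

/-- Cases for a semicomplete digraph on four vertices with all cuts of size two. -/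
def fourVertexTree : CaseTree 4 :=
  .split 0 1 (.split 0 2 (.split 0 3 (.split 1 2 (.split 1 3 (.split 2 3 (.split 2 0 (.split 2 1
  (.split 1 0 (.split 3 0 (.split 3 1 (.leaf 17302530) (.split 3 2 (.leaf 17302530) (.cut 8)))
  (.split 3 1 (.split 3 2 (.leaf 67176450) (.cut 8)) (.split 3 2 (.cut 8) (.cut 8)))) (.split 3
  0 (.split 3 1 (.leaf 16910340) (.split 3 2 (.leaf 17302530) (.cut 8))) (.cut 14))) (.split 3 1
  (.split 3 0 (.leaf 33621000) (.split 3 2 (.split 1 0 (.leaf 67176450) (.cut 14)) (.cut 8)))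
  (.cut 13))) (.split 2 1 (.split 3 0 (.split 1 0 (.split 3 1 (.leaf 17302530) (.split 3 2
  (.leaf 17302530) (.cut 8))) (.cut 14)) (.split 3 1 (.split 3 2 (.split 1 0 (.cut 14) (.cut
  14)) (.cut 8)) (.cut 12))) (.cut 4))) (.split 3 2 (.split 2 0 (.split 2 1 (.split 3 0 (.leaf
  16910340) (.split 3 1 (.split 1 0 (.leaf 67176450) (.cut 14)) (.cut 8))) (.cut 4)) (.split 2 1
  (.cut 4) (.cut 4))) (.pair 2 3))) (.split 3 1 (.split 1 0 (.split 2 3 (.split 2 0 (.split 3 0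
  (.leaf 17302530) (.split 3 2 (.leaf 34078980) (.cut 8))) (.split 2 1 (.split 3 0 (.leaf
  17302530) (.cut 14)) (.cut 4))) (.cut 7)) (.cut 2)) (.pair 1 3))) (.split 2 1 (.split 3 2
  (.split 1 3 (.split 1 0 (.split 2 0 (.split 3 0 (.leaf 67176450) (.split 3 1 (.leaf 67176450)
  (.cut 8))) (.split 2 3 (.split 3 0 (.leaf 67240200) (.cut 14)) (.cut 4))) (.cut 2)) (.split 3
  1 (.split 1 0 (.cut 2) (.cut 2)) (.pair 1 3))) (.cut 11)) (.pair 1 2))) (.split 3 0 (.split 1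
  2 (.split 1 3 (.split 2 3 (.split 2 0 (.split 3 1 (.split 1 0 (.leaf 34078980) (.split 2 1
  (.leaf 16910340) (.split 3 2 (.leaf 67176450) (.leaf 108)))) (.split 3 2 (.split 2 1 (.leaf
  17302530) (.cut 13)) (.cut 8))) (.split 2 1 (.split 1 0 (.split 3 1 (.leaf 17302530) (.split 3
  2 (.leaf 17302530) (.cut 8))) (.cut 14)) (.cut 4))) (.cut 7)) (.split 3 1 (.split 1 0 (.split
  2 3 (.cut 7) (.cut 7)) (.cut 2)) (.pair 1 3))) (.split 2 1 (.split 1 3 (.split 1 0 (.split 2 3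
  (.split 3 2 (.split 2 0 (.leaf 67176450) (.split 3 1 (.leaf 34078980) (.leaf 156))) (.cut 11))
  (.cut 7)) (.cut 2)) (.cut 3)) (.pair 1 2))) (.pair 0 3))) (.split 2 0 (.split 0 3 (.split 1 2
  (.split 3 2 (.split 1 3 (.split 2 1 (.split 3 0 (.split 1 0 (.leaf 67240200) (.split 2 3
  (.leaf 17302530) (.split 3 1 (.leaf 33621000) (.leaf 120)))) (.split 3 1 (.split 1 0 (.leaf
  67176450) (.cut 14)) (.cut 8))) (.split 2 3 (.split 3 1 (.split 1 0 (.leaf 67176450) (.split 3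
  0 (.leaf 17302530) (.cut 14))) (.cut 13)) (.cut 4))) (.split 3 1 (.split 1 0 (.split 2 3
  (.split 2 1 (.leaf 67240200) (.split 3 0 (.leaf 17302530) (.leaf 216))) (.cut 7)) (.cut 2))
  (.pair 1 3))) (.cut 11)) (.split 2 1 (.split 1 3 (.split 1 0 (.split 3 2 (.cut 11) (.cut 11))
  (.cut 2)) (.cut 3)) (.pair 1 2))) (.cut 1)) (.pair 0 2))) (.split 1 0 (.split 0 2 (.split 0 3
  (.split 1 2 (.split 1 3 (.split 2 3 (.split 2 0 (.split 3 1 (.split 2 1 (.split 3 0 (.leaf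
  16910340) (.split 3 2 (.leaf 34078980) (.cut 8))) (.cut 13)) (.split 3 2 (.split 3 0 (.split 2
  1 (.cut 13) (.cut 13)) (.cut 8)) (.cut 9))) (.split 2 1 (.split 3 1 (.split 3 0 (.leaf
  16910340) (.cut 14)) (.cut 13)) (.cut 4))) (.split 3 2 (.split 2 1 (.split 2 0 (.split 3 1
  (.leaf 33621000) (.cut 13)) (.cut 4)) (.cut 5)) (.pair 2 3))) (.split 3 1 (.split 2 3 (.split
  2 1 (.split 3 0 (.split 2 0 (.leaf 33621000) (.split 3 2 (.leaf 67240200) (.leaf 180)))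
  (.split 3 2 (.split 2 0 (.leaf 33621000) (.cut 14)) (.cut 8))) (.cut 13)) (.cut 7)) (.pair 1
  3))) (.split 2 1 (.split 1 3 (.split 3 2 (.split 3 1 (.split 2 0 (.split 2 3 (.leaf 34078980)
  (.split 3 0 (.leaf 16910340) (.leaf 228))) (.split 2 3 (.split 3 0 (.leaf 16910340) (.cut 14))
  (.cut 4))) (.cut 13)) (.cut 11)) (.cut 2)) (.pair 1 2))) (.cut 1)) (.split 2 0 (.split 0 3
  (.cut 1) (.cut 1)) (.pair 0 2))) (.pair 0 1))

/-- Cases for a semicomplete digraph on three vertices with all cuts of size two. -/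
def threeVertexTree : CaseTree 3 :=
  .split 0 1 (.split 0 2 (.split 1 2 (.split 1 0 (.split 2 1 (.split 2 0 (.leaf 66562) (.cut 4))
  (.cut 5)) (.cut 2)) (.cut 3)) (.cut 1)) (.split 1 0 (.split 0 2 (.cut 1) (.cut 1)) (.pair 0
  1))

/-- The vertex listed at position `i` of a permutation of `Fin 4` written in base four. -/
def baseFour (p : ℕ) (i : Fin 4) : Fin 4 := ⟨p / 4 ^ i.val % 4, Nat.mod_lt _ (by omega)⟩

/-- The code `L₁` contains a strong tournament labelled by the permutation `p`. -/
def containsTournament (p L₁ : ℕ) : Bool :=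
  let f := baseFour p
  decide (Function.Injective f) && hasArc L₁ (f 0) (f 1) && hasArc L₁ (f 1) (f 2) &&
    hasArc L₁ (f 2) (f 3) && hasArc L₁ (f 3) (f 0) && hasArc L₁ (f 0) (f 2) &&
    hasArc L₁ (f 1) (f 3)

/-- The arcs are exactly known, and form a copy of `S4` labelled by the permutation `p`. -/
def isExceptional (p L₁ F : ℕ) : Bool :=
  let f := baseFour p
  decide (Function.Injective f ∧ ∀ i j : Fin 4,
    if i ≠ j ∧ j ≠ finSucc i then hasArc L₁ (f i) (f j) = true
    else i = j ∨ (hasArc F (f i) (f j) = true ∧ hasArc L₁ (f i) (f j) = false))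

lemma fiveVertexTree_check : fiveVertexTree.check 2 0 (fun A L₁ L₂ _ => splitsInto 5 A L₁ L₂)
    8859945984 0 0 = true := by
  decide +kernel

lemma fourCycleTree_check : fourCycleTree.check 1 0 (fun p L₁ _ _ => containsTournament p L₁)
    0 0 0 = true := by
  decide +kernel

lemma fourVertexTree_check : fourVertexTree.check 2 (2 ^ 64 - 1)
    (fun A L₁ L₂ F => splitsInto 4 A L₁ L₂ || (L₂ == 0 && isExceptional A L₁ F)) 0 0 0 = true := by
  decide +kernel

lemma threeVertexTree_check : threeVertexTree.check 2 (2 ^ 64 - 1)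
    (fun A L₁ L₂ _ => splitsInto 3 A L₁ L₂) 0 0 0 = true := by
  decide +kernel

/-! ### Deleting a vertex -/

section Reduction

variable {V : Type*}

/-- Adds one arc from `u` to `w`. -/
noncomputable def addArc (m : V → V → ℕ) (u w : V) : V → V → ℕ :=
  open Classical in fun x y => m x y + if x = u ∧ y = w then 1 else 0

lemma exists_arc_of_arcCount_pos {m : V → V → ℕ} {S R : Finset V} (h : 0 < arcCount m S R) :
    ∃ x ∈ S, ∃ y ∈ R, m x y ≠ 0 := by
  obtain ⟨x, hx, h⟩ := Finset.exists_ne_zero_of_sum_ne_zero h.ne'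
  obtain ⟨y, hy, h⟩ := Finset.exists_ne_zero_of_sum_ne_zero h
  exact ⟨x, hx, y, hy, h⟩

lemma le_arcCount {m : V → V → ℕ} {S R : Finset V} {x y : V} (hx : x ∈ S) (hy : y ∈ R) :
    m x y ≤ arcCount m S R :=
  (Finset.single_le_sum (f := fun y => m x y) (fun _ _ => Nat.zero_le _) hy).trans
    (Finset.single_le_sum (f := fun x => ∑ y ∈ R, m x y) (fun _ _ => Nat.zero_le _) hx)

lemma arcCount_swap (m : V → V → ℕ) (S R : Finset V) :
    arcCount (fun x y => m y x) S R = arcCount m R S :=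
  Finset.sum_comm

lemma SemiOn.swap {m : V → V → ℕ} {X : Finset V} (h : SemiOn m X) :
    SemiOn (fun x y => m y x) X :=
  fun x hx y hy hxy => (h x hx y hy hxy).symm

lemma SemiOn.subset {m : V → V → ℕ} {X Y : Finset V} (h : SemiOn m X) (hY : Y ⊆ X) :
    SemiOn m Y :=
  fun x hx y hy hxy => h x (hY hx) y (hY hy) hxy

lemma SemiOn.card_mul_card_le {m : V → V → ℕ} {Y S R : Finset V} (h : SemiOn m Y) (hS : S ⊆ Y)
    (hR : R ⊆ Y) (hd : Disjoint S R) : S.card * R.card ≤ arcCount m S R + arcCount m R S := by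
  rw [← arcCount_swap m S R]
  simp only [arcCount, ← Finset.sum_add_distrib]
  calc S.card * R.card = ∑ x ∈ S, ∑ y ∈ R, 1 := by simp
    _ ≤ _ := by
      refine Finset.sum_le_sum fun x hx => Finset.sum_le_sum fun y hy => ?_
      have := h x (hS hx) y (hR hy) (fun e => Finset.disjoint_left.1 hd hx (e ▸ hy))
      omega

variable [DecidableEq V]

lemma arcCount_union_left {m : V → V → ℕ} {S T R : Finset V} (h : Disjoint S T) :
    arcCount m (S ∪ T) R = arcCount m S R + arcCount m T R :=
  Finset.sum_union h

lemma arcCount_union_right {m : V → V → ℕ} {S R T : Finset V} (h : Disjoint R T) :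
    arcCount m S (R ∪ T) = arcCount m S R + arcCount m S T := by
  simp only [arcCount, ← Finset.sum_add_distrib]
  exact Finset.sum_congr rfl fun x _ => Finset.sum_union h

lemma CutAtLeast.cutStrong {k : ℕ} {m : V → V → ℕ} {X : Finset V} (h : CutAtLeast k m X)
    (hk : 0 < k) : CutStrong (fun x y => m x y ≠ 0) X := by
  intro S hS hne hnX
  obtain ⟨x, hx, y, hy, hxy⟩ := exists_arc_of_arcCount_pos (hk.trans_le (h S hS hne hnX))
  rw [mem_sdiff] at hy
  exact ⟨x, hx, y, hy.1, hy.2, hxy⟩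

lemma CutStrong.cutAtLeast_one {m : V → V → ℕ} {X : Finset V}
    (h : CutStrong (fun x y => m x y ≠ 0) X) : CutAtLeast 1 m X := by
  intro S hS hne hnX
  obtain ⟨x, hx, y, hy, hyS, hxy⟩ := h S hS hne hnX
  exact (Nat.one_le_iff_ne_zero.2 hxy).trans (le_arcCount hx (mem_sdiff.2 ⟨hy, hyS⟩))

lemma CutStrong.swap {A : V → V → Prop} {X : Finset V} (h : CutStrong A X) :
    CutStrong (fun x y => A y x) X := by
  intro S hS hne hnX
  obtain ⟨x, hx, y, hy, hyS, hxy⟩ := h (X \ S) sdiff_subset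
    (sdiff_nonempty.2 fun h => hnX (hS.antisymm h))
    (fun e => by obtain ⟨s, hs⟩ := hne; have := hS hs; rw [← e] at this; simp_all)
  rw [mem_sdiff] at hx hyS
  exact ⟨y, by tauto, x, hx.1, hx.2, hxy⟩

lemma CutAtLeast.swap {k : ℕ} {m : V → V → ℕ} {X : Finset V} (h : CutAtLeast k m X) :
    CutAtLeast k (fun x y => m y x) X := by
  intro S hS hne hnX
  have := h (X \ S) sdiff_subset
    (sdiff_nonempty.2 fun h => hnX (hS.antisymm h))
    (fun e => by obtain ⟨s, hs⟩ := hne; have := hS hs; rw [← e] at this; simp_all)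
  rw [Finset.sdiff_sdiff_eq_self hS] at this
  rwa [arcCount_swap]

/-- In a multidigraph without cuts of size one, no cut consists of a single arc `p → q`. -/
lemma CutAtLeast.not_single {m : V → V → ℕ} {X S : Finset V} (h : CutAtLeast 2 m X)
    (hS : S ⊆ X) (hne : S.Nonempty) (hnX : S ≠ X) {p q : V} (hpq : m p q ≤ 1)
    (hout : ∀ x ∈ S, ∀ y ∈ X, y ∉ S → m x y ≠ 0 → x = p ∧ y = q) : False := by
  have h2 := h S hS hne hnX
  have : arcCount m S (X \ S) ≤
      ∑ x ∈ S, ∑ y ∈ X \ S, if x = p then if y = q then 1 else 0 else 0 := by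
    refine Finset.sum_le_sum fun x hx => Finset.sum_le_sum fun y hy => ?_
    rw [mem_sdiff] at hy
    by_cases h0 : m x y = 0
    · simp [h0]
    · obtain ⟨rfl, rfl⟩ := hout x hx y hy.1 hy.2 h0
      simpa using hpq
  have h3 : ∑ x ∈ S, ∑ y ∈ X \ S, (if x = p then if y = q then 1 else 0 else 0) ≤ 1 := by
    have : ∀ x ∈ S, ∑ y ∈ X \ S, (if x = p then if y = q then 1 else 0 else 0)
        ≤ if x = p then 1 else 0 := by
      intro x _
      split_ifs
      · rw [Finset.sum_ite_eq']; split_ifs <;> simp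
      · simp
    refine (Finset.sum_le_sum this).trans ?_
    rw [Finset.sum_ite_eq']; split_ifs <;> simp
  omega

/-- Attaching a vertex `v` to a strong digraph, possibly subdividing some arcs. -/
lemma CutStrong.attach {A B : V → V → Prop} {X : Finset V} {v p q : V}
    (hA : CutStrong A (X.erase v)) (hp : p ∈ X.erase v) (hq : q ∈ X.erase v)
    (hpv : B p v) (hvq : B v q)
    (hAB : ∀ x ∈ X.erase v, ∀ y ∈ X.erase v, A x y → B x y ∨ (B x v ∧ B v y)) (hv : v ∈ X) :
    CutStrong B X := by
  intro S hS hne hnX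
  rw [mem_erase] at hp hq
  by_cases h0 : (S.erase v).Nonempty
  · by_cases h1 : S.erase v = X.erase v
    · have hvS : v ∉ S := by
        intro h
        refine hnX ?_
        rw [← insert_erase h, h1, insert_erase hv]
      refine ⟨p, ?_, v, hv, hvS, hpv⟩
      have : p ∈ X.erase v := mem_erase.2 hp
      rw [← h1] at this
      exact mem_of_mem_erase this
    · obtain ⟨x, hx, y, hy, hyS, hxy⟩ := hA _ (erase_subset_erase v hS) h0 h1
      have hx' := erase_subset_erase v hS hx
      have hy' := mem_erase.1 hy
      have hyS' : y ∉ S := fun h => hyS (mem_erase.2 ⟨hy'.1, h⟩)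
      rcases hAB x hx' y hy hxy with h | ⟨h, h'⟩
      · exact ⟨x, mem_of_mem_erase hx, y, hy'.2, hyS', h⟩
      · by_cases hvS : v ∈ S
        · exact ⟨v, hvS, y, hy'.2, hyS', h'⟩
        · exact ⟨x, mem_of_mem_erase hx, v, hv, hvS, h⟩
  · have hS' : S = {v} := by
      rw [Finset.not_nonempty_iff_eq_empty, erase_eq_empty_iff] at h0
      exact h0.resolve_left hne.ne_empty
    subst hS'
    exact ⟨v, by simp, q, hq.2, by simpa using hq.1, hvq⟩

/-- A second arc into `v`. -/
lemma CutAtLeast.exists_second_in {m : V → V → ℕ} {X : Finset V} (h : CutAtLeast 2 m X) {v : V}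
    (hv : v ∈ X) (u : V) (hu : u ∈ X.erase v) :
    ∃ p ∈ X.erase v, m p v ≠ 0 ∧ (p = u → 2 ≤ m p v) := by
  by_contra! hc
  refine h.not_single (S := X.erase v) (erase_subset _ _) ⟨u, hu⟩ (fun e => ?_) (p := u) (q := v)
    ?_ ?_
  · rw [← e] at hv; simp at hv
  · by_cases h0 : m u v = 0
    · omega
    · have := (hc u hu h0).2; omega
  · intro x hx y hy hyS h0
    have hyv : y = v := by by_contra hne; exact hyS (mem_erase.2 ⟨hne, hy⟩)
    subst hyv
    exact ⟨(hc x hx h0).1, rfl⟩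

lemma CutAtLeast.exists_second_out {m : V → V → ℕ} {X : Finset V} (h : CutAtLeast 2 m X) {v : V}
    (hv : v ∈ X) (w : V) (hw : w ∈ X.erase v) :
    ∃ q ∈ X.erase v, m v q ≠ 0 ∧ (q = w → 2 ≤ m v q) :=
  h.swap.exists_second_in hv w hw

/-- If the multidigraph obtained by deleting `v` and adding an arc `u → w`, where `u → v → w`,
has a good decomposition, then so does the original one. -/
theorem Decomposable.of_erase {m : V → V → ℕ} {X : Finset V} (h : CutAtLeast 2 m X) {v u w : V}
    (hv : v ∈ X) (hu : u ∈ X.erase v) (hw : w ∈ X.erase v) (huv : m u v ≠ 0) (hvw : m v w ≠ 0)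
    (hd : Decomposable (addArc m u w) (X.erase v)) : Decomposable m X := by
  obtain ⟨A, B, hA, hB, hAB, hAs, hBs⟩ := hd
  wlog hwlog : B u w → A u w generalizing A B
  · exact this B A hB hA (fun x y h1 h2 => hAB x y h2 h1) hBs hAs (by tauto)
  obtain ⟨p, hp, hpv, hpu⟩ := h.exists_second_in hv u hu
  obtain ⟨q, hq, hvq, hqw⟩ := h.exists_second_out hv w hw
  have addArc_of_ne : ∀ x y, ¬ (x = u ∧ y = w) → addArc m u w x y = m x y := by
    intro x y hxy; simp [addArc, hxy]
  have addArc_self : addArc m u w u w = m u w + 1 := by simp [addArc]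
  rw [mem_erase] at hu hw hp hq
  refine ⟨fun x y => (x ≠ v ∧ y ≠ v ∧ ¬ (x = u ∧ y = w) ∧ A x y) ∨ (x = u ∧ y = v) ∨
      (x = v ∧ y = w), fun x y => (x ≠ v ∧ y ≠ v ∧ B x y) ∨ (x = p ∧ y = v) ∨
      (x = v ∧ y = q), ?_, ?_, ?_, ?_, ?_⟩
  · rintro x y (⟨_, _, h1, h2⟩ | ⟨rfl, rfl⟩ | ⟨rfl, rfl⟩)
    · rw [← addArc_of_ne x y h1]; exact hA x y h2
    · omega
    · omega
  · rintro x y (⟨_, _, h2⟩ | ⟨rfl, rfl⟩ | ⟨rfl, rfl⟩)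
    · by_cases h1 : x = u ∧ y = w
      · obtain ⟨rfl, rfl⟩ := h1
        have := hAB x y (hwlog h2) h2
        omega
      · rw [← addArc_of_ne x y h1]; exact hB x y h2
    · omega
    · omega
  · rintro x y (⟨h3, h4, h1, h2⟩ | ⟨rfl, rfl⟩ | ⟨rfl, rfl⟩) (⟨h5, h6, h7⟩ | ⟨h5, h6⟩ | ⟨h5, h6⟩)
    · rw [← addArc_of_ne x y h1]; exact hAB x y h2 h7
    · exact absurd h6 h4
    · exact absurd h5 h3
    · exact absurd rfl h6
    · exact h5 ▸ hpu h5.symm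
    · exact absurd h5 hu.1
    · exact absurd rfl h5
    · exact absurd h6 hw.1
    · exact h6 ▸ hqw h6.symm
  · refine hAs.attach (v := v) (mem_erase.2 hu) (mem_erase.2 hw) (Or.inr (Or.inl ⟨rfl, rfl⟩))
      (Or.inr (Or.inr ⟨rfl, rfl⟩)) (fun x hx y hy hxy => ?_) hv
    by_cases h1 : x = u ∧ y = w
    · exact Or.inr ⟨Or.inr (Or.inl ⟨h1.1, rfl⟩), Or.inr (Or.inr ⟨rfl, h1.2⟩)⟩
    · exact Or.inl (Or.inl ⟨ne_of_mem_erase hx, ne_of_mem_erase hy, h1, hxy⟩)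
  · exact hBs.attach (v := v) (mem_erase.2 hp) (mem_erase.2 hq) (Or.inr (Or.inl ⟨rfl, rfl⟩))
      (Or.inr (Or.inr ⟨rfl, rfl⟩)) (fun x hx y hy hxy => Or.inl (Or.inl
        ⟨ne_of_mem_erase hx, ne_of_mem_erase hy, hxy⟩)) hv

/-! ### Small cuts after deleting a vertex -/

/-- `S` is a proper nonempty subset of `Y` left by at most one arc. -/
def Deficient (m : V → V → ℕ) (Y S : Finset V) : Prop :=
  S ⊆ Y ∧ S.Nonempty ∧ S ≠ Y ∧ arcCount m S (Y \ S) ≤ 1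

/-- At most one vertex of `Y` has out-degree at most one in `Y`. -/
def NoWeakPair (m : V → V → ℕ) (Y : Finset V) : Prop :=
  ∀ a ∈ Y, ∀ b ∈ Y, arcCount m {a} (Y \ {a}) ≤ 1 → arcCount m {b} (Y \ {b}) ≤ 1 → a = b

lemma Deficient.swap {m : V → V → ℕ} {Y S : Finset V} (h : Deficient m Y S) :
    Deficient (fun x y => m y x) Y (Y \ S) := by
  obtain ⟨h1, h2, h3, h4⟩ := h
  refine ⟨sdiff_subset, sdiff_nonempty.2 fun h => h3 (h1.antisymm h), fun e => ?_, ?_⟩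
  · obtain ⟨s, hs⟩ := h2
    have := h1 hs
    rw [← e] at this
    simp_all
  · rwa [Finset.sdiff_sdiff_eq_self h1, arcCount_swap]

/-- Two disjoint deficient sets are singletons. -/
lemma Deficient.not_disjoint {m : V → V → ℕ} {Y S R : Finset V}
    (hs : CutStrong (fun x y => m x y ≠ 0) Y) (hsemi : SemiOn m Y) (hcard : 4 ≤ Y.card)
    (hno : NoWeakPair m Y) (hS : Deficient m Y S) (hR : Deficient m Y R) : ¬ Disjoint S R := by
  intro hd
  have hle := hsemi.card_mul_card_le hS.1 hR.1 hd
  have hSp := hS.2.1.card_pos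
  have hRp := hR.2.1.card_pos
  have hdef : arcCount m S R + arcCount m S (Y \ (S ∪ R)) ≤ 1 := by
    rw [← arcCount_union_right (by
      rw [Finset.disjoint_left]; intro x hx; simp [hx])]
    convert hS.2.2.2 using 2
    ext x
    have := @hR.1 x
    have := fun h : x ∈ S => Finset.disjoint_left.1 hd h
    simp only [mem_union, mem_sdiff]
    tauto
  have hdef' : arcCount m R S + arcCount m R (Y \ (S ∪ R)) ≤ 1 := by
    rw [← arcCount_union_right (by
      rw [Finset.disjoint_left]; intro x hx; simp [hx])]
    convert hR.2.2.2 using 2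
    ext x
    have := @hS.1 x
    have := fun h : x ∈ S => Finset.disjoint_left.1 hd h
    simp only [mem_union, mem_sdiff]
    tauto
  by_cases hY : S ∪ R = Y
  · have : Y.card = S.card + R.card := by rw [← hY, card_union_of_disjoint hd]
    have h2 : S.card * R.card ≤ 2 := by omega
    have : S.card ≤ 2 := by nlinarith
    have : R.card ≤ 2 := by nlinarith
    interval_cases S.card <;> omega
  · have h1 := hs.cutAtLeast_one (S ∪ R) (union_subset hS.1 hR.1)
      (hS.2.1.mono subset_union_left) hY
    rw [arcCount_union_left hd] at h1
    have h2 : S.card * R.card ≤ 1 := by omega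
    have e1 : S.card = 1 := by nlinarith
    have e2 : R.card = 1 := by nlinarith
    obtain ⟨a, rfl⟩ := card_eq_one.1 e1
    obtain ⟨b, rfl⟩ := card_eq_one.1 e2
    have := hno a (hS.1 (by simp)) b (hR.1 (by simp)) hS.2.2.2 hR.2.2.2
    simp [this] at hd

/-- Deficient sets that intersect and do not cover `Y` are nested. -/
lemma Deficient.nested {m : V → V → ℕ} {Y S R : Finset V}
    (hs : CutStrong (fun x y => m x y ≠ 0) Y) (hsemi : SemiOn m Y)
    (hS : Deficient m Y S) (hR : Deficient m Y R) (hi : ¬ Disjoint S R) (hu : S ∪ R ≠ Y) :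
    S ⊆ R ∨ R ⊆ S := by
  by_contra! hc
  obtain ⟨hSR, hRS⟩ := hc
  have dPQ : Disjoint (S ∩ R) (S \ R) := by
    rw [Finset.disjoint_left]; intro x; simp only [mem_inter, mem_sdiff]; tauto
  have dPW : Disjoint (S ∩ R) (R \ S) := by
    rw [Finset.disjoint_left]; intro x; simp only [mem_inter, mem_sdiff]; tauto
  have dQW : Disjoint (S \ R) (R \ S) := by
    rw [Finset.disjoint_left]; intro x; simp only [mem_sdiff]; tauto
  have dWZ : Disjoint (R \ S) (Y \ (S ∪ R)) := by
    rw [Finset.disjoint_left]; intro x; simp only [mem_union, mem_sdiff]; tauto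
  have dQZ : Disjoint (S \ R) (Y \ (S ∪ R)) := by
    rw [Finset.disjoint_left]; intro x; simp only [mem_union, mem_sdiff]; tauto
  have dQWZ : Disjoint ((S \ R) ∪ (R \ S)) (Y \ (S ∪ R)) := by
    rw [Finset.disjoint_left]; intro x; simp only [mem_union, mem_sdiff]; tauto
  have eS : arcCount m S (Y \ S) = arcCount m ((S ∩ R) ∪ (S \ R)) ((R \ S) ∪ (Y \ (S ∪ R))) := by
    congr 1 <;> ext x <;> have := @hS.1 x <;> have := @hR.1 x <;>
      simp only [mem_union, mem_inter, mem_sdiff] <;> tauto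
  have eR : arcCount m R (Y \ R) = arcCount m ((S ∩ R) ∪ (R \ S)) ((S \ R) ∪ (Y \ (S ∪ R))) := by
    congr 1 <;> ext x <;> have := @hS.1 x <;> have := @hR.1 x <;>
      simp only [mem_union, mem_inter, mem_sdiff] <;> tauto
  have eI : arcCount m (S ∩ R) (Y \ (S ∩ R)) =
      arcCount m (S ∩ R) (((S \ R) ∪ (R \ S)) ∪ (Y \ (S ∪ R))) := by
    congr 1; ext x; have := @hS.1 x; have := @hR.1 x
    simp only [mem_union, mem_inter, mem_sdiff]; tauto
  have eU : arcCount m (S ∪ R) (Y \ (S ∪ R)) =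
      arcCount m (((S ∩ R) ∪ (S \ R)) ∪ (R \ S)) (Y \ (S ∪ R)) := by
    congr 1; ext x
    simp only [mem_union, mem_inter, mem_sdiff]; tauto
  have dPQW : Disjoint ((S ∩ R) ∪ (S \ R)) (R \ S) := by
    rw [Finset.disjoint_left]; intro x; simp only [mem_union, mem_inter, mem_sdiff]; tauto
  have hI := hs.cutAtLeast_one (S ∩ R) (inter_subset_left.trans hS.1)
    (Finset.not_disjoint_iff_nonempty_inter.1 hi)
    (fun e => hS.2.2.1 (hS.1.antisymm (e ▸ inter_subset_left)))
  have hU := hs.cutAtLeast_one (S ∪ R) (union_subset hS.1 hR.1) (hS.2.1.mono subset_union_left) hu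
  have h1 := hS.2.2.2
  have h2 := hR.2.2.2
  rw [eS, arcCount_union_left dPQ, arcCount_union_right dWZ, arcCount_union_right dWZ] at h1
  rw [eR, arcCount_union_left dPW, arcCount_union_right dQZ, arcCount_union_right dQZ] at h2
  rw [eI, arcCount_union_right dQWZ, arcCount_union_right dQW] at hI
  rw [eU, arcCount_union_left dPQW, arcCount_union_left dPQ] at hU
  have h3 := hsemi.card_mul_card_le (S := S \ R) (R := R \ S) (sdiff_subset.trans hS.1)
    (sdiff_subset.trans hR.1) dQW
  have h4 := (sdiff_nonempty.2 hSR).card_pos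
  have h5 := (sdiff_nonempty.2 hRS).card_pos
  have h6 : 1 ≤ (S \ R).card * (R \ S).card := Nat.mul_pos h4 h5
  omega

lemma Deficient.chain {m : V → V → ℕ} {Y S R : Finset V}
    (hs : CutStrong (fun x y => m x y ≠ 0) Y) (hsemi : SemiOn m Y) (hcard : 4 ≤ Y.card)
    (hno : NoWeakPair m Y) (hno' : NoWeakPair (fun x y => m y x) Y)
    (hS : Deficient m Y S) (hR : Deficient m Y R) : S ⊆ R ∨ R ⊆ S := by
  refine hS.nested hs hsemi hR (hS.not_disjoint hs hsemi hcard hno hR) fun hu => ?_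
  refine hS.swap.not_disjoint hs.swap hsemi.swap hcard hno' hR.swap ?_
  rw [Finset.disjoint_left]
  intro x
  rw [mem_sdiff, mem_sdiff, ← hu, mem_union]
  tauto

/-- The vertex `v` can be deleted, adding a single arc, so that all cuts keep size two. -/
lemma exists_addArc {m : V → V → ℕ} {X : Finset V} (h : CutAtLeast 2 m X) (hsemi : SemiOn m X)
    {v : V} (hv : v ∈ X) (hcard : 5 ≤ X.card)
    (hs : CutStrong (fun x y => m x y ≠ 0) (X.erase v)) (hno : NoWeakPair m (X.erase v))
    (hno' : NoWeakPair (fun x y => m y x) (X.erase v)) :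
    ∃ u ∈ X.erase v, ∃ w ∈ X.erase v, m u v ≠ 0 ∧ m v w ≠ 0 ∧
      CutAtLeast 2 (addArc m u w) (X.erase v) := by
  classical
  set Y := X.erase v with hY
  have hvY : v ∉ Y := by simp [hY]
  have hYX : Y ⊆ X := erase_subset _ _
  have hcardY : 4 ≤ Y.card := by rw [hY, card_erase_of_mem hv]; omega
  have chain : ∀ {S R}, Deficient m Y S → Deficient m Y R → S ⊆ R ∨ R ⊆ S :=
    fun hS hR => hS.chain hs (hsemi.subset hYX) hcardY hno hno' hR
  have hdec : X = Y ∪ {v} := by ext x; by_cases hx : x = v <;> simp [hY, hx, hv]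
  have hUin : ∃ u ∈ Y, m u v ≠ 0 ∧ ∀ S, Deficient m Y S → u ∈ S := by
    let D := Y.powerset.filter (Deficient m Y)
    by_cases hD : D.Nonempty
    · obtain ⟨S, hS, hmin⟩ := D.exists_min_image Finset.card hD
      have hS' : Deficient m Y S := (mem_filter.1 hS).2
      have h2 := h S (hS'.1.trans hYX) hS'.2.1 (fun e => hvY (hS'.1 (e ▸ hv)))
      have e : X \ S = (Y \ S) ∪ {v} := by
        ext x
        have : x ∈ S → x ≠ v := fun hx e => hvY (hS'.1 (e ▸ hx))
        rw [hdec]; simp only [mem_union, mem_sdiff, mem_singleton]; tauto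
      rw [e, arcCount_union_right (by simp [hvY])] at h2
      obtain ⟨u, hu, y, hy, huy⟩ := exists_arc_of_arcCount_pos (m := m) (S := S) (R := {v})
        (by have := hS'.2.2.2; omega)
      rw [mem_singleton] at hy
      subst hy
      refine ⟨u, hS'.1 hu, huy, fun R hR => ?_⟩
      rcases chain hS' hR with hc | hc
      · exact hc hu
      · have := hmin R (mem_filter.2 ⟨mem_powerset.2 hR.1, hR⟩)
        rw [Finset.eq_of_subset_of_card_le hc this]; exact hu
    · have hYne : Y.Nonempty := card_pos.1 (by omega)
      obtain ⟨u, hu⟩ := hYne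
      obtain ⟨p, hp, hpv, _⟩ := h.exists_second_in hv u hu
      refine ⟨p, hp, hpv, fun S hS => absurd ⟨S, ?_⟩ hD⟩
      exact mem_filter.2 ⟨mem_powerset.2 hS.1, hS⟩
  have hWout : ∃ w ∈ Y, m v w ≠ 0 ∧ ∀ S, Deficient m Y S → w ∉ S := by
    let D := Y.powerset.filter (Deficient m Y)
    by_cases hD : D.Nonempty
    · obtain ⟨S, hS, hmax⟩ := D.exists_max_image Finset.card hD
      have hS' : Deficient m Y S := (mem_filter.1 hS).2
      have h2 := h (S ∪ {v}) (by rw [hdec]; exact union_subset_union_left hS'.1)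
        (hS'.2.1.mono subset_union_left) (fun e => hS'.2.2.1 (hS'.1.antisymm fun x hx => by
          have := hYX hx
          rw [← e, mem_union, mem_singleton] at this
          exact this.resolve_right fun e => hvY (e ▸ hx)))
      have e : X \ (S ∪ {v}) = Y \ S := by
        ext x
        by_cases hx : x = v <;> simp [hY, hx]
      rw [e, arcCount_union_left (by simpa using fun hx => hvY (hS'.1 hx))] at h2
      obtain ⟨y, hy, w, hw, huy⟩ := exists_arc_of_arcCount_pos (m := m) (S := {v}) (R := Y \ S)
        (by have := hS'.2.2.2; omega)
      rw [mem_singleton] at hy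
      subst hy
      rw [mem_sdiff] at hw
      refine ⟨w, hw.1, huy, fun R hR => ?_⟩
      rcases chain hS' hR with hc | hc
      · have := hmax R (mem_filter.2 ⟨mem_powerset.2 hR.1, hR⟩)
        rw [← Finset.eq_of_subset_of_card_le hc this]; exact hw.2
      · exact fun hwR => hw.2 (hc hwR)
    · have hYne : Y.Nonempty := card_pos.1 (by omega)
      obtain ⟨u, hu⟩ := hYne
      obtain ⟨p, hp, hpv, _⟩ := h.exists_second_out hv u hu
      refine ⟨p, hp, hpv, fun S hS => absurd ⟨S, ?_⟩ hD⟩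
      exact mem_filter.2 ⟨mem_powerset.2 hS.1, hS⟩
  obtain ⟨u, hu, huv, hu'⟩ := hUin
  obtain ⟨w, hw, hvw, hw'⟩ := hWout
  refine ⟨u, hu, w, hw, huv, hvw, fun S hS hne hnY => ?_⟩
  have hle : arcCount m S (Y \ S) ≤ arcCount (addArc m u w) S (Y \ S) :=
    Finset.sum_le_sum fun x _ => Finset.sum_le_sum fun y _ => by simp [addArc]
  by_cases hdS : Deficient m Y S
  · have h1 := hs.cutAtLeast_one S hS hne hnY
    have hlt : arcCount m S (Y \ S) < arcCount (addArc m u w) S (Y \ S) := by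
      refine Finset.sum_lt_sum (fun x _ => Finset.sum_le_sum fun y _ => by simp [addArc])
        ⟨u, hu' S hdS, Finset.sum_lt_sum (fun y _ => by simp [addArc])
          ⟨w, mem_sdiff.2 ⟨hw, hw' S hdS⟩, by simp [addArc]⟩⟩
    omega
  · have : ¬ arcCount m S (Y \ S) ≤ 1 := fun h => hdS ⟨hS, hne, hnY, h⟩
    omega

/-! ### Choosing the vertex to delete -/

lemma cutStrong_insert_path {A : V → V → Prop} {X : Finset V} {x y : V} (hX : X.Nonempty)
    (hx : ∀ z ∈ X, A z x) (hxy : A x y) (hy : ∀ z ∈ X, A y z) :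
    CutStrong A (insert x (insert y X)) := by
  intro S hS hne hnX
  by_contra! hc
  have hxS : x ∈ S → y ∈ S := fun h => by
    by_contra h'
    exact hc x h y (by simp) h' hxy
  have hyS : y ∈ S → ∀ z ∈ X, z ∈ S := fun h z hz => by
    by_contra h'
    exact hc y h z (by simp [hz]) h' (hy z hz)
  have hzS : ∀ z ∈ X, z ∈ S → x ∈ S := fun z hz h => by
    by_contra h'
    exact hc z h x (by simp) h' (hx z hz)
  obtain ⟨z, hz⟩ := hX
  have hxS' : x ∈ S := by
    obtain ⟨s, hs⟩ := hne
    have := hS hs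
    simp only [mem_insert] at this
    rcases this with rfl | rfl | h
    · exact hs
    · exact hzS z hz (hyS hs z hz)
    · exact hzS s h hs
  refine hnX (hS.antisymm ?_)
  intro w hw
  simp only [mem_insert] at hw
  rcases hw with rfl | rfl | h
  · exact hxS'
  · exact hxS hxS'
  · exact hyS (hxS hxS') w h

/-- A strong semicomplete digraph on at least four vertices has a nonseparating vertex. -/
lemma CutStrong.exists_erase {m : V → V → ℕ} {X : Finset V}
    (hs : CutStrong (fun x y => m x y ≠ 0) X) (hsemi : SemiOn m X) (hcard : 4 ≤ X.card) :
    ∃ v ∈ X, CutStrong (fun x y => m x y ≠ 0) (X.erase v) := by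
  classical
  by_contra! hno
  let D := X.powerset.filter fun S => S.Nonempty ∧ S ≠ X ∧ CutStrong (fun x y => m x y ≠ 0) S
  have hD : D.Nonempty := by
    obtain ⟨a, ha⟩ := card_pos.1 (by omega : 0 < X.card)
    refine ⟨{a}, mem_filter.2 ⟨by simpa using ha, by simp, fun e => ?_, ?_⟩⟩
    · rw [← e] at hcard; simp at hcard
    · intro S hS hne hnX
      exact absurd ((subset_singleton_iff.1 hS).resolve_left hne.ne_empty) hnX
  obtain ⟨Z, hZ, hmax⟩ := D.exists_max_image Finset.card hD
  obtain ⟨hZX, hZne, hZnX, hZs⟩ := mem_filter.1 hZ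
  rw [mem_powerset] at hZX
  have hmax' : ∀ R ⊆ X, Z.card < R.card → CutStrong (fun x y => m x y ≠ 0) R → R = X := by
    intro R hR hlt hRs
    by_contra hRX
    have := hmax R (mem_filter.2 ⟨mem_powerset.2 hR, card_pos.1 (by omega), hRX, hRs⟩)
    omega
  have hone : ∀ v ∈ X, v ∉ Z → ∀ p ∈ Z, ∀ q ∈ Z, m p v ≠ 0 → m v q ≠ 0 → False := by
    intro v hv hvZ p hp q hq hpv hvq
    have e : (insert v Z).erase v = Z := erase_insert hvZ
    have h1 := hmax' (insert v Z) (insert_subset hv hZX) (by rw [card_insert_of_notMem hvZ]; omega)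
      (CutStrong.attach (v := v) (by rw [e]; exact hZs) (by rwa [e]) (by rwa [e]) hpv hvq
        (fun _ _ _ _ h => Or.inl h) (by simp))
    refine hno v hv ?_
    rw [← h1, e]
    exact hZs
  obtain ⟨y₀, hy₀, q₀, hq₀, hq₀', hyq₀⟩ := hs (X \ Z) sdiff_subset
    (sdiff_nonempty.2 fun h => hZnX (hZX.antisymm h))
    (fun e => by obtain ⟨s, hs⟩ := hZne; have := hZX hs; rw [← e] at this; simp_all)
  have hq₀Z : q₀ ∈ Z := by
    rw [mem_sdiff] at hq₀'
    tauto
  rw [mem_sdiff] at hy₀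
  let O := X.filter fun v => v ∉ Z ∧ ∀ q ∈ Z, m v q = 0
  have hO : ∀ v, v ∈ O ↔ v ∈ X ∧ v ∉ Z ∧ ∀ q ∈ Z, m v q = 0 := by simp [O]
  obtain ⟨x, hx, y, hy, hyS, hxy⟩ := hs (Z ∪ O) (union_subset hZX (filter_subset _ _))
    (hZne.mono subset_union_left) (fun e => by
      have := hy₀.1
      rw [← e, mem_union, hO] at this
      rcases this with h | h
      · exact hy₀.2 h
      · exact hyq₀ (h.2.2 q₀ hq₀Z))
  simp only [mem_union, hO, not_or, not_and, not_forall, exists_prop] at hx hyS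
  obtain ⟨hyZ, hyS⟩ := hyS
  obtain ⟨q, hq, hyq⟩ := hyS hy hyZ
  have hx : x ∈ X ∧ x ∉ Z ∧ ∀ q ∈ Z, m x q = 0 :=
    hx.resolve_left fun h => hone y hy hyZ x h q hq hxy hyq
  have hzx : ∀ z ∈ Z, m z x ≠ 0 := fun z hz =>
    (hsemi z (hZX hz) x hx.1 (fun e => hx.2.1 (e ▸ hz))).resolve_right (by simp [hx.2.2 z hz])
  have hyz : ∀ z ∈ Z, m y z ≠ 0 := fun z hz =>
    (hsemi y hy z (hZX hz) (fun e => hyZ (e ▸ hz))).resolve_right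
      (fun h => hone y hy hyZ z hz q hq h hyq)
  have hne : x ≠ y := by
    rintro rfl
    exact hyq (hx.2.2 q hq)
  have hxyZ : x ∉ insert y Z := by simp [hne, hx.2.1]
  have hfull := hmax' (insert x (insert y Z)) (insert_subset hx.1 (insert_subset hy hZX))
    (by rw [card_insert_of_notMem hxyZ, card_insert_of_notMem hyZ]; omega)
    (cutStrong_insert_path hZne hzx hxy hyz)
  have hZcard : 2 ≤ Z.card := by
    rw [← hfull, card_insert_of_notMem hxyZ, card_insert_of_notMem hyZ] at hcard
    omega
  obtain ⟨z, hz⟩ := hZne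
  refine hno z (hZX hz) ?_
  have e : X.erase z = insert x (insert y (Z.erase z)) := by
    rw [← hfull, erase_insert_of_ne (ne_of_mem_of_not_mem hz hx.2.1).symm,
      erase_insert_of_ne (ne_of_mem_of_not_mem hz hyZ).symm]
  rw [e]
  exact cutStrong_insert_path (card_pos.1 (by rw [card_erase_of_mem hz]; omega))
    (fun w hw => hzx w (mem_of_mem_erase hw)) hxy (fun w hw => hyz w (mem_of_mem_erase hw))

/-- Two vertices of out-degree one lie on a path `a → b → c` of arcs of multiplicity one. -/
lemma exists_path_of_not_noWeakPair {m : V → V → ℕ} {Y : Finset V}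
    (hs : CutStrong (fun x y => m x y ≠ 0) Y) (hsemi : SemiOn m Y) (hcard : 3 ≤ Y.card)
    (hno : ¬ NoWeakPair m Y) :
    ∃ a ∈ Y, ∃ b ∈ Y, ∃ c ∈ Y, a ≠ b ∧ a ≠ c ∧ b ≠ c ∧ m a b = 1 ∧ m b c = 1 ∧
      (∀ x ∈ Y, x ≠ a → x ≠ b → m a x = 0) ∧ ∀ x ∈ Y, x ≠ b → x ≠ c → m b x = 0 := by
  have single : ∀ {a b}, b ∈ Y → a ≠ b → m a b ≠ 0 → arcCount m {a} (Y \ {a}) ≤ 1 →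
      m a b = 1 ∧ ∀ x ∈ Y, x ≠ a → x ≠ b → m a x = 0 := by
    intro a b hb hab h0 hle
    have hb' : b ∈ Y \ {a} := by simp [hb, hab.symm]
    rw [arcCount, sum_singleton, ← Finset.add_sum_erase _ _ hb'] at hle
    refine ⟨by omega, fun x hx hxa hxb => ?_⟩
    have := Finset.single_le_sum (f := fun y => m a y) (fun _ _ => Nat.zero_le _)
      (show x ∈ (Y \ {a}).erase b by simp [hx, hxa, hxb])
    omega
  unfold NoWeakPair at hno
  push Not at hno
  obtain ⟨a, ha, b, hb, hda, hdb, hab⟩ := hno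
  wlog h0 : m a b ≠ 0 generalizing a b
  · exact this b hb a ha hdb hda hab.symm ((hsemi a ha b hb hab).resolve_left h0)
  obtain ⟨h1, h2⟩ := single hb hab h0 hda
  obtain ⟨x, hx, c, hc, hcS, hxc⟩ := hs {a, b} (by simp [insert_subset_iff, ha, hb]) (by simp)
    (fun e => by
      have : ({a, b} : Finset V).card ≤ 2 := card_le_two
      rw [e] at this; omega)
  simp only [mem_insert, mem_singleton, not_or] at hx hcS
  have hxb : x = b := hx.resolve_left (by rintro rfl; exact hxc (h2 c hc hcS.1 hcS.2))
  subst hxb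
  obtain ⟨h3, h4⟩ := single hc (Ne.symm hcS.2) hxc hdb
  exact ⟨a, ha, x, hb, c, hc, hab, Ne.symm hcS.1, Ne.symm hcS.2, h1, h3, h2, h4⟩

lemma exists_erase_of_not_noWeakPair {m : V → V → ℕ} {X : Finset V} (h : CutAtLeast 2 m X)
    (hsemi : SemiOn m X) (hcard : 6 ≤ X.card) {v : V} (hv : v ∈ X)
    (hs : CutStrong (fun x y => m x y ≠ 0) (X.erase v)) (hno : ¬ NoWeakPair m (X.erase v)) :
    ∃ a ∈ X, CutStrong (fun x y => m x y ≠ 0) (X.erase a) ∧ NoWeakPair m (X.erase a) ∧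
      NoWeakPair (fun x y => m y x) (X.erase a) := by
  have hcard' : ∀ u ∈ X, 5 ≤ (X.erase u).card := fun u hu => by
    rw [card_erase_of_mem hu]; omega
  obtain ⟨a, ha, b, hb, c, hc, hab, hac, hbc, mab, mbc, za, zb⟩ := exists_path_of_not_noWeakPair hs
    (hsemi.subset (erase_subset _ _)) (by have := hcard' v hv; omega) hno
  have hsX := h.cutStrong (by omega)
  rw [mem_erase] at ha hb hc
  obtain ⟨hav, ha⟩ := ha
  obtain ⟨hbv, hb⟩ := hb
  obtain ⟨hcv, hc⟩ := hc
  have za' : ∀ x ∈ X, x ≠ a → x ≠ b → x ≠ v → m a x = 0 := fun x hx h1 h2 h3 =>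
    za x (mem_erase.2 ⟨h3, hx⟩) h1 h2
  have zb' : ∀ x ∈ X, x ≠ b → x ≠ c → x ≠ v → m b x = 0 := fun x hx h1 h2 h3 =>
    zb x (mem_erase.2 ⟨h3, hx⟩) h1 h2
  have ib : ∀ x ∈ X, x ≠ b → x ≠ c → x ≠ v → m x b ≠ 0 := fun x hx h1 h2 h3 =>
    (hsemi x hx b hb h1).resolve_right (by simp [zb' x hx h1 h2 h3])
  have ne4 : ∀ p q r s : V, ({p, q, r, s} : Finset V) ≠ X := fun p q r s e => by
    have : ({p, q, r, s} : Finset V).card ≤ 4 := card_le_four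
    rw [e] at this; omega
  have mbv : m b v ≠ 0 := by
    intro h0
    refine h.not_single (S := {b}) (by simpa using hb) (by simp)
      (fun e => ne4 b b b b (by simpa using e)) (p := b) (q := c) (by omega) ?_
    intro x hx y hy hyS hxy
    rw [mem_singleton] at hx hyS
    subst hx
    refine ⟨rfl, ?_⟩
    by_contra hyc
    by_cases hyv : y = v
    · exact hxy (hyv ▸ h0)
    · exact hxy (zb' y hy hyS hyc hyv)
  have hstrong : CutStrong (fun x y => m x y ≠ 0) (X.erase a) := by
    intro S hS hne hnX
    by_contra! hcl
    have haS : a ∉ S := fun hx => ne_of_mem_erase (hS hx) rfl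
    have hcl' : ∀ x ∈ S, ∀ y ∈ X, y ≠ a → m x y ≠ 0 → y ∈ S := fun x hx y hy hya hxy => by
      by_contra hyS
      exact hxy (hcl x hx y (mem_erase.2 ⟨hya, hy⟩) hyS)
    have hSX : S ⊆ X := hS.trans (erase_subset _ _)
    have hbS : b ∉ S := by
      intro hbS
      have hcS : c ∈ S := hcl' b hbS c hc hac.symm (by omega)
      have hvS : v ∈ S := hcl' b hbS v hv hav.symm mbv
      obtain ⟨x, hx, y, hy, hyS, hxy⟩ := hsX (insert a S) (insert_subset ha hSX) (by simp)
        (fun e => hnX (by rw [← e, erase_insert haS]))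
      simp only [mem_insert, not_or] at hx hyS
      rcases hx with rfl | hx
      · exact hxy (za' y hy hyS.1 (fun e => hyS.2 (e ▸ hbS)) (fun e => hyS.2 (e ▸ hvS)))
      · exact hyS.2 (hcl' x hx y hy hyS.1 hxy)
    have hScv : ∀ x ∈ S, x = c ∨ x = v := by
      intro x hx
      by_contra! hxcv
      exact hbS (hcl' x hx b hb hab.symm
        (ib x (hSX hx) (fun e => hbS (e ▸ hx)) hxcv.1 hxcv.2))
    by_cases hvS : v ∈ S
    · refine h.not_single (S := insert a S) (insert_subset ha hSX) (by simp)
        (fun e => by rw [← e, mem_insert] at hb; tauto) (p := a) (q := b) (by omega) ?_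
      intro x hx y hy hyS hxy
      simp only [mem_insert, not_or] at hx hyS
      rcases hx with rfl | hx
      · refine ⟨rfl, ?_⟩
        by_contra hyb
        exact hxy (za' y hy hyS.1 hyb (fun e => hyS.2 (e ▸ hvS)))
      · exact absurd (hcl' x hx y hy hyS.1 hxy) hyS.2
    · have hcS : c ∈ S := by
        obtain ⟨x, hx⟩ := hne
        rcases hScv x hx with rfl | rfl
        · exact hx
        · exact absurd hx hvS
      obtain ⟨x, hx, y, hy, hyS, hxy⟩ := hs {a, b, c}
        (by simp [insert_subset_iff, ha, hb, hc, hav, hbv, hcv]) (by simp) (fun e => by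
          have : ({a, b, c} : Finset V).card ≤ 3 := card_le_three
          have := hcard' v hv
          rw [e] at *; omega)
      simp only [mem_insert, mem_singleton, not_or] at hx hyS
      rcases hx with rfl | rfl | rfl
      · exact hxy (za y hy hyS.1 hyS.2.1)
      · exact hxy (zb y hy hyS.2.1 hyS.2.2)
      · rcases hScv y (hcl' x hcS y (mem_of_mem_erase hy) hyS.1 hxy) with e | e
        · exact hyS.2.2 e
        · exact ne_of_mem_erase hy e
  refine ⟨a, ha, hstrong, ?_, ?_⟩
  · by_contra hno'
    obtain ⟨a', ha', b', hb', c', hc', hab', hac', hbc', mab', mbc', za₁, zb₁⟩ :=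
      exists_path_of_not_noWeakPair hstrong (hsemi.subset (erase_subset _ _))
        (by have := hcard' a ha; omega) hno'
    rw [mem_erase] at ha' hb' hc'
    obtain ⟨haa', ha'⟩ := ha'
    obtain ⟨hba', hb'⟩ := hb'
    obtain ⟨hca', hc'⟩ := hc'
    have za₂ : ∀ x ∈ X, x ≠ a → x ≠ a' → x ≠ b' → m a' x = 0 := fun x hx h1 h2 h3 =>
      za₁ x (mem_erase.2 ⟨h1, hx⟩) h2 h3
    have zb₂ : ∀ x ∈ X, x ≠ a → x ≠ b' → x ≠ c' → m b' x = 0 := fun x hx h1 h2 h3 =>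
      zb₁ x (mem_erase.2 ⟨h1, hx⟩) h2 h3
    have ha'b : a' ≠ b := by
      rintro rfl
      by_cases hcb : c = b'
      · exact mbv (za₂ v hv hav.symm hbv.symm (fun e => hcv (hcb.trans e.symm)))
      · have := za₂ c hc hac.symm hbc.symm hcb
        omega
    have hb'b : b' ≠ b := by
      rintro rfl
      by_cases hcb : c = c'
      · exact mbv (zb₂ v hv hav.symm hbv.symm (fun e => hcv (hcb.trans e.symm)))
      · have := zb₂ c hc hac.symm hbc.symm hcb
        omega
    have ha'cv : a' = c ∨ a' = v := by
      by_contra! hn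
      exact ib a' ha' ha'b hn.1 hn.2 (za₂ b hb hab.symm ha'b.symm hb'b.symm)
    by_cases hb'cv : b' = c ∨ b' = v
    · refine h.not_single (S := {a, b, a', b'}) (by simp [insert_subset_iff, ha, hb, ha', hb'])
        (by simp) (ne4 _ _ _ _) (p := b') (q := c') (by omega) ?_
      intro x hx y hy hyS hxy
      simp only [mem_insert, mem_singleton, not_or] at hx hyS
      have hyc : y ≠ c := by
        rintro rfl
        rcases ha'cv with e | e <;> rcases hb'cv with e' | e' <;> simp_all
      have hyv : y ≠ v := by
        rintro rfl
        rcases ha'cv with e | e <;> rcases hb'cv with e' | e' <;> simp_all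
      rcases hx with rfl | rfl | rfl | rfl
      · exact absurd (za' y hy hyS.1 hyS.2.1 hyv) hxy
      · exact absurd (zb' y hy hyS.2.1 hyc hyv) hxy
      · exact absurd (za₂ y hy hyS.1 hyS.2.2.1 hyS.2.2.2) hxy
      · refine ⟨rfl, ?_⟩
        by_contra hyc'
        exact hxy (zb₂ y hy hyS.1 hyS.2.2.2 hyc')
    · push Not at hb'cv
      have hc'b : c' = b := by
        by_contra hn
        exact ib b' hb' hb'b hb'cv.1 hb'cv.2 (zb₂ b hb hab.symm hb'b.symm (Ne.symm hn))
      rcases ha'cv with rfl | rfl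
      · obtain ⟨x, hx, y, hy, hyS, hxy⟩ := hs {a, b, a', b'}
          (by simp [insert_subset_iff, ha, hb, ha', hb', hav, hbv, hcv, hb'cv.2]) (by simp)
          (fun e => by
            have : ({a, b, a', b'} : Finset V).card ≤ 4 := card_le_four
            have := hcard' v hv
            rw [e] at *; omega)
        simp only [mem_insert, mem_singleton, not_or] at hx hyS
        have hy' := mem_of_mem_erase hy
        rcases hx with rfl | rfl | rfl | rfl
        · exact hxy (za y hy hyS.1 hyS.2.1)
        · exact hxy (zb y hy hyS.2.1 hyS.2.2.1)
        · exact hxy (za₂ y hy' hyS.1 hyS.2.2.1 hyS.2.2.2)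
        · exact hxy (zb₂ y hy' hyS.1 hyS.2.2.2 (hc'b ▸ hyS.2.1))
      · refine h.not_single (S := {a, b, a', b'}) (by simp [insert_subset_iff, ha, hb, ha', hb'])
          (by simp) (ne4 _ _ _ _) (p := b) (q := c) (by omega) ?_
        intro x hx y hy hyS hxy
        simp only [mem_insert, mem_singleton, not_or] at hx hyS
        rcases hx with rfl | rfl | rfl | rfl
        · exact absurd (za' y hy hyS.1 hyS.2.1 hyS.2.2.1) hxy
        · refine ⟨rfl, ?_⟩
          by_contra hyc
          exact hxy (zb' y hy hyS.2.1 hyc hyS.2.2.1)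
        · exact absurd (za₂ y hy hyS.1 hyS.2.2.1 hyS.2.2.2) hxy
        · exact absurd (zb₂ y hy hyS.1 hyS.2.2.2 (hc'b ▸ hyS.2.1)) hxy
  · by_contra hno'
    obtain ⟨a', ha', b', hb', c', hc', hab', hac', hbc', mab', mbc', za₁, zb₁⟩ :=
      exists_path_of_not_noWeakPair hstrong.swap (hsemi.subset (erase_subset _ _)).swap
        (by have := hcard' a ha; omega) hno'
    rw [mem_erase] at ha' hb' hc'
    obtain ⟨haa', ha'⟩ := ha'
    obtain ⟨hba', hb'⟩ := hb'
    obtain ⟨hca', hc'⟩ := hc'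
    have in_le : ∀ p q, p ∈ X → m q p = 1 → (∀ x ∈ X.erase a, x ≠ p → x ≠ q → m x p = 0) →
        p ≠ a → p = b ∨ p = v := by
      intro p q hp hqp hz hpa
      by_contra! hn
      refine h.swap.not_single (S := {p}) (by simpa using hp) (by simp)
        (fun e => ne4 p p p p (by simpa using e)) (p := p) (q := q) (by omega) ?_
      intro x hx y hy hyS hxy
      rw [mem_singleton] at hx hyS
      subst hx
      refine ⟨rfl, ?_⟩
      by_contra hyq
      by_cases hya : y = a
      · subst hya
        exact hxy (za' x hp hpa hn.1 hn.2)
      · exact hxy (hz y (mem_erase.2 ⟨hya, hy⟩) hyS hyq)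
    have hb_in : ∀ d, ¬ ∀ x ∈ X.erase a, x ≠ b → x ≠ d → m x b = 0 := by
      intro d hz
      obtain ⟨x, hx, hxn⟩ := Finset.exists_mem_notMem_of_card_lt_card
        (s := {a, b, c, v, d}) (t := X) (lt_of_le_of_lt card_le_five (by omega))
      simp only [mem_insert, mem_singleton, not_or] at hxn
      exact ib x hx hxn.2.1 hxn.2.2.1 hxn.2.2.2.1
        (hz x (mem_erase.2 ⟨hxn.1, hx⟩) hxn.2.1 hxn.2.2.2.2)
    rcases in_le a' b' ha' mab' za₁ haa' with rfl | rfl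
    · exact hb_in _ za₁
    · rcases in_le b' c' hb' mbc' zb₁ hba' with rfl | rfl
      · exact hb_in _ zb₁
      · exact hab' rfl

lemma exists_erase_noWeakPair {m : V → V → ℕ} {X : Finset V} (h : CutAtLeast 2 m X)
    (hsemi : SemiOn m X) (hcard : 6 ≤ X.card) :
    ∃ v ∈ X, CutStrong (fun x y => m x y ≠ 0) (X.erase v) ∧ NoWeakPair m (X.erase v) ∧
      NoWeakPair (fun x y => m y x) (X.erase v) := by
  obtain ⟨v, hv, hs⟩ := (h.cutStrong (by omega)).exists_erase hsemi (by omega)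
  by_cases h1 : NoWeakPair m (X.erase v)
  · by_cases h2 : NoWeakPair (fun x y => m y x) (X.erase v)
    · exact ⟨v, hv, hs, h1, h2⟩
    · obtain ⟨a, ha, h3, h4, h5⟩ :=
        exists_erase_of_not_noWeakPair h.swap hsemi.swap hcard hv hs.swap h2
      exact ⟨a, ha, h3.swap, h5, h4⟩
  · exact exists_erase_of_not_noWeakPair h hsemi hcard hv hs h1
end Reduction

/-! ### Transfer along embeddings -/

section Transfer

variable {U V : Type*}

lemma CutAtLeast.comap [Fintype U] [DecidableEq U] [DecidableEq V] {k : ℕ} {m : V → V → ℕ}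
    {f : U ↪ V} (h : CutAtLeast k m (univ.map f)) :
    CutAtLeast k (fun i j => m (f i) (f j)) univ := by
  intro S _ hne hnu
  have := h (S.map f) (map_subset_map.2 (subset_univ S)) hne.map
    fun e => hnu (map_injective f e)
  rw [← Finset.map_sdiff, arcCount, sum_map] at this
  simpa only [arcCount, sum_map] using this

lemma SemiOn.comap [Fintype U] {m : V → V → ℕ} {f : U ↪ V} (h : SemiOn m (univ.map f)) :
    SemiOn (fun i j => m (f i) (f j)) univ :=
  fun i _ j _ hij => h (f i) (by simp) (f j) (by simp) (f.injective.ne hij)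

lemma CutStrong.map [Fintype U] {A : U → U → Prop} (f : U ↪ V) (h : CutStrong A univ) :
    CutStrong (Relation.Map A f f) (univ.map f) := by
  intro S hS hne hnX
  obtain ⟨R, -, rfl⟩ := subset_map_iff.1 hS
  obtain ⟨x, hx, y, -, hy, hxy⟩ := h R (subset_univ _) (map_nonempty.1 hne)
    (fun e => hnX (by rw [e]))
  exact ⟨f x, by simpa using hx, f y, by simp, by simpa using hy, x, y, hxy, rfl, rfl⟩

lemma Decomposable.map [Fintype U] {m : V → V → ℕ} {f : U ↪ V}
    (h : Decomposable (fun i j => m (f i) (f j)) univ) : Decomposable m (univ.map f) := by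
  obtain ⟨A, B, hA, hB, hAB, hAs, hBs⟩ := h
  refine ⟨_, _, ?_, ?_, ?_, hAs.map f, hBs.map f⟩
  · rintro _ _ ⟨x, y, hxy, rfl, rfl⟩
    exact hA x y hxy
  · rintro _ _ ⟨x, y, hxy, rfl, rfl⟩
    exact hB x y hxy
  · rintro _ _ ⟨x, y, hxy, rfl, rfl⟩ ⟨x', y', hxy', hx, hy⟩
    rw [f.injective hx, f.injective hy] at hxy'
    exact hAB x y hxy hxy'

lemma exists_map_univ_eq {X : Finset V} {n : ℕ} (h : X.card = n) :
    ∃ f : Fin n ↪ V, univ.map f = X := by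
  refine ⟨(X.equivFinOfCardEq h).symm.toEmbedding.trans (Function.Embedding.subtype _), ?_⟩
  ext x
  simp only [mem_map, mem_univ, true_and, Function.Embedding.trans_apply,
    Equiv.coe_toEmbedding, Function.Embedding.subtype_apply]
  refine ⟨?_, fun hx => ⟨X.equivFinOfCardEq h ⟨x, hx⟩, by simp⟩⟩
  rintro ⟨i, rfl⟩
  exact Subtype.prop _

end Transfer

/-! ### Semicomplete multidigraphs on at least five vertices -/

section Multidigraph

variable {V : Type*} [DecidableEq V]

lemma exists_strong_tournament {m : V → V → ℕ} {X : Finset V} (h : CutAtLeast 1 m X)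
    (hsemi : SemiOn m X) (hcard : X.card = 4) :
    ∃ g : Fin 4 ↪ V, univ.map g = X ∧ m (g 0) (g 1) ≠ 0 ∧ m (g 1) (g 2) ≠ 0 ∧
      m (g 2) (g 3) ≠ 0 ∧ m (g 3) (g 0) ≠ 0 ∧ m (g 0) (g 2) ≠ 0 ∧ m (g 1) (g 3) ≠ 0 := by
  obtain ⟨e, rfl⟩ := exists_map_univ_eq hcard
  obtain ⟨p, L₁, L₂, F, hm, hp⟩ := CaseTree.exists_leaf (by omega) hsemi.comap h.comap
    (G := 0) (by simp [hasArc]) fourCycleTree 0 0 0 (fun x y => by simp [hasArc, lowMult])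
    fourCycleTree_check
  simp only [containsTournament, Bool.and_eq_true, decide_eq_true_eq] at hp
  obtain ⟨⟨⟨⟨⟨⟨hinj, h1⟩, h2⟩, h3⟩, h4⟩, h5⟩, h6⟩ := hp
  have arc : ∀ x y, hasArc L₁ x y = true → m (e x) (e y) ≠ 0 := by
    intro x y hxy
    have := (hm x y).1
    simp only [lowMult, hxy, Bool.toNat_true] at this
    omega
  refine ⟨⟨e ∘ baseFour p, e.injective.comp hinj⟩, ?_, arc _ _ h1, arc _ _ h2, arc _ _ h3,
    arc _ _ h4, arc _ _ h5, arc _ _ h6⟩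
  refine Finset.eq_of_subset_of_card_le ?_ (by simp)
  intro x
  simp only [mem_map, mem_univ, true_and]
  rintro ⟨i, rfl⟩
  exact ⟨_, rfl⟩

lemma decomposable_of_card_eq_five {m : V → V → ℕ} {X : Finset V} (h : CutAtLeast 2 m X)
    (hsemi : SemiOn m X) (hcard : X.card = 5) : Decomposable m X := by
  obtain ⟨v, hv, hs⟩ := (h.cutStrong (by omega)).exists_erase hsemi (by omega)
  obtain ⟨g, hg, h1, h2, h3, h4, h5, h6⟩ := exists_strong_tournament hs.cutAtLeast_one
    (hsemi.subset (erase_subset _ _)) (by rw [card_erase_of_mem hv, hcard])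
  have hvg : v ∉ Set.range g := by
    rintro ⟨i, hi⟩
    have : g i ∈ X.erase v := by rw [← hg]; simp
    exact ne_of_mem_erase this hi
  let f : Fin 5 ↪ V := ⟨Fin.cons v g, Fin.cons_injective_iff.2 ⟨hvg, g.injective⟩⟩
  have hf : univ.map f = X := by
    rw [← insert_erase hv, ← hg]
    ext x
    simp only [mem_map, mem_univ, true_and, mem_insert, Fin.exists_fin_succ, f,
      Function.Embedding.coeFn_mk, Fin.cons_zero, Fin.cons_succ, eq_comm]
  subst hf
  have key : ∀ x y : Fin 5, hasArc 8859945984 x y = true → ∃ i j : Fin 4, x = i.succ ∧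
      y = j.succ ∧ (i = 0 ∧ j = 1 ∨ i = 1 ∧ j = 2 ∨ i = 2 ∧ j = 3 ∨ i = 3 ∧ j = 0 ∨
        i = 0 ∧ j = 2 ∨ i = 1 ∧ j = 3) := by
    decide
  have hstart : Meets (fun i j => m (f i) (f j)) 8859945984 0 0 := by
    intro x y
    refine ⟨?_, by simp [hasArc]⟩
    change lowMult 8859945984 0 x y ≤ m (f x) (f y)
    by_cases hxy : hasArc 8859945984 x y = true
    · obtain ⟨i, j, rfl, rfl, hij⟩ := key x y hxy
      have h0 : m (g i) (g j) ≠ 0 := by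
        rcases hij with ⟨rfl, rfl⟩ | ⟨rfl, rfl⟩ | ⟨rfl, rfl⟩ | ⟨rfl, rfl⟩ | ⟨rfl, rfl⟩ |
          ⟨rfl, rfl⟩ <;> assumption
      have e : m (f i.succ) (f j.succ) = m (g i) (g j) := rfl
      rw [e, lowMult, hxy]
      simp [hasArc]
      omega
    · rw [lowMult, Bool.eq_false_iff.2 hxy]
      simp [hasArc]
  obtain ⟨A, L₁, L₂, F, hm, hA⟩ := CaseTree.exists_leaf (by omega) hsemi.comap h.comap
    (G := 0) (by simp [hasArc]) fiveVertexTree _ _ _ hstart fiveVertexTree_check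
  exact (decomposable_of_splitsInto hm hA).map

/-- A semicomplete multidigraph on at least five vertices, all of whose cuts have at least two
arcs, has a good decomposition. -/
theorem decomposable_of_cutAtLeast_two {m : V → V → ℕ} {X : Finset V} (h : CutAtLeast 2 m X)
    (hsemi : SemiOn m X) (hcard : 5 ≤ X.card) : Decomposable m X := by
  induction hn : X.card generalizing m X with
  | zero => omega
  | succ n ih =>
    by_cases h5 : X.card = 5
    · exact decomposable_of_card_eq_five h hsemi h5
    · obtain ⟨v, hv, hs, hno, hno'⟩ := exists_erase_noWeakPair h hsemi (by omega)
      obtain ⟨u, hu, w, hw, huv, hvw, hcut⟩ := exists_addArc h hsemi hv hcard hs hno hno'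
      have hcard' : (X.erase v).card = n := by rw [card_erase_of_mem hv]; omega
      refine Decomposable.of_erase h hv hu hw huv hvw (ih hcut (fun x hx y hy hxy => ?_) (by omega)
        hcard')
      have := hsemi x (mem_of_mem_erase hx) y (mem_of_mem_erase hy) hxy
      simp only [addArc]
      omega

end Multidigraph

/-! ### Semicomplete digraphs -/

/-- The multidigraph of a digraph. -/
noncomputable def arcIndicator {V : Type*} (T : V → V → Prop) : V → V → ℕ :=
  open Classical in fun x y => if T x y then 1 else 0

lemma arcIndicator_le_one {V : Type*} (T : V → V → Prop) (x y : V) : arcIndicator T x y ≤ 1 := by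
  unfold arcIndicator
  split_ifs <;> simp

lemma arcIndicator_ne_zero {V : Type*} {T : V → V → Prop} {x y : V} :
    arcIndicator T x y ≠ 0 ↔ T x y := by
  simp [arcIndicator]

lemma Semicomplete.semiOn {V : Type*} {T : V → V → Prop} (h : Semicomplete T) (X : Finset V) :
    SemiOn (arcIndicator T) X := by
  intro x _ y _ hxy
  simpa only [arcIndicator_ne_zero] using h x y hxy

lemma TwoArcStrong.cutAtLeast {V : Type*} [Fintype V] [DecidableEq V] {T : V → V → Prop}
    (h : TwoArcStrong T) : CutAtLeast 2 (arcIndicator T) univ := by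
  classical
  intro S _ hne hnu
  by_contra! hlt
  have hcard : ((S ×ˢ (univ \ S)).filter fun p => T p.1 p.2).card ≤ 1 := by
    rw [card_filter, sum_product]
    unfold arcCount arcIndicator at hlt
    convert Nat.le_of_lt_succ hlt
  obtain ⟨x, hx⟩ := hne
  obtain ⟨y, hy⟩ : ∃ y, y ∉ S := by
    by_contra! hc
    exact hnu (eq_univ_iff_forall.2 hc)
  have hstay := h ↑((S ×ˢ (univ \ S)).filter fun p => T p.1 p.2)
    (fun p hp q hq => card_le_one.1 hcard p hp q hq) x y
  have : ∀ z, Relation.ReflTransGen (fun x y => T x y ∧ (x, y) ∉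
      (((S ×ˢ (univ \ S)).filter fun p => T p.1 p.2 : Finset (V × V)) : Set (V × V))) x z →
      z ∈ S := by
    intro z hz
    induction hz with
    | refl => exact hx
    | tail _ hbc ih =>
      by_contra hc
      refine hbc.2 ?_
      simp [ih, hc, hbc.1]
  exact hy (this y hstay)

lemma CutStrong.isStrong {V : Type*} [Fintype V] {A : V → V → Prop} (h : CutStrong A univ) :
    IsStrong A := by
  classical
  intro x y
  by_contra hxy
  obtain ⟨a, ha, b, -, hb, hab⟩ := h (univ.filter fun z => Relation.ReflTransGen A x z)
    (subset_univ _) ⟨x, by simp [Relation.ReflTransGen.refl]⟩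
    (fun e => by
      have := mem_univ y
      rw [← e] at this
      exact hxy (mem_filter.1 this).2)
  simp only [mem_filter, mem_univ, true_and] at ha hb
  exact hb (ha.tail hab)

lemma Decomposable.goodDecomp {V : Type*} [Fintype V] {T : V → V → Prop}
    (h : Decomposable (arcIndicator T) univ) : GoodDecomp T := by
  obtain ⟨A, B, hA, hB, hAB, hAs, hBs⟩ := h
  have ne : ∀ {x y}, 1 ≤ arcIndicator T x y → T x y := fun h =>
    arcIndicator_ne_zero.1 (Nat.one_le_iff_ne_zero.1 h)
  refine ⟨A, B, fun x y h => ne (hA x y h), fun x y h => ne (hB x y h), ?_, hAs.isStrong,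
    hBs.isStrong⟩
  rintro x y ⟨h1, h2⟩
  have := hAB x y h1 h2
  have := arcIndicator_le_one T x y
  omega

lemma goodDecomp_or_diso_four {T : Fin 4 → Fin 4 → Prop} (hT : Irreflexive T)
    (hTsc : Semicomplete T) (hT2 : TwoArcStrong T) :
    GoodDecomp T ∨ ∃ e : Equiv.Perm (Fin 4), ∀ i j, S4Arc i j ↔ T (e i) (e j) := by
  obtain ⟨A, L₁, L₂, F, hm, hA⟩ := CaseTree.exists_leaf (by omega) (hTsc.semiOn univ)
    hT2.cutAtLeast (fun x y _ => arcIndicator_le_one T x y) fourVertexTree 0 0 0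
    (fun x y => by simp [hasArc, lowMult]) fourVertexTree_check
  rw [Bool.or_eq_true, Bool.and_eq_true, beq_iff_eq] at hA
  rcases hA with hA | ⟨rfl, hA⟩
  · exact Or.inl (decomposable_of_splitsInto hm hA).goodDecomp
  · simp only [isExceptional, decide_eq_true_eq] at hA
    obtain ⟨hinj, hA⟩ := hA
    refine Or.inr ⟨Equiv.ofBijective _ (Finite.injective_iff_bijective.1 hinj), fun i j => ?_⟩
    simp only [Equiv.ofBijective_apply]
    have hij := hA i j
    have hmij := hm (baseFour A i) (baseFour A j)
    rw [← arcIndicator_ne_zero (T := T)]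
    unfold S4Arc
    split_ifs at hij with hc
    · simp only [lowMult, hij, Bool.toNat_true] at hmij
      exact iff_of_true hc (by omega)
    · refine iff_of_false hc ?_
      rcases hij with rfl | ⟨h1, h2⟩
      · rw [arcIndicator_ne_zero]
        exact hT _
      · have := hmij.2 h1
        simp only [lowMult, h2] at this
        simpa [hasArc] using this

theorem goodDecomp_or_diso {t : ℕ} (ht : 2 ≤ t) {T : Fin t → Fin t → Prop} (hT : Irreflexive T)
    (hTsc : Semicomplete T) (hT2 : TwoArcStrong T) :
    GoodDecomp T ∨ ∃ e : Fin 4 ≃ Fin t, ∀ i j, S4Arc i j ↔ T (e i) (e j) := by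
  by_cases h5 : 5 ≤ t
  · exact Or.inl (decomposable_of_cutAtLeast_two hT2.cutAtLeast (hTsc.semiOn univ)
      (by simpa using h5)).goodDecomp
  · obtain rfl | rfl | rfl : t = 2 ∨ t = 3 ∨ t = 4 := by omega
    · have := hT2.cutAtLeast {0} (subset_univ _) (by simp) (by decide)
      have e : (univ \ {0} : Finset (Fin 2)) = {1} := by decide
      rw [e] at this
      simp only [arcCount, sum_singleton] at this
      have := arcIndicator_le_one T 0 1
      omega
    · obtain ⟨A, L₁, L₂, F, hm, hA⟩ := CaseTree.exists_leaf (by omega) (hTsc.semiOn univ)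
        hT2.cutAtLeast (fun x y _ => arcIndicator_le_one T x y) threeVertexTree 0 0 0
        (fun x y => by simp [hasArc, lowMult]) threeVertexTree_check
      exact Or.inl (decomposable_of_splitsInto hm hA).goodDecomp
    · exact goodDecomp_or_diso_four hT hTsc hT2

/-! ### Compositions -/

lemma IsStrong.comap {U W : Type*} [Nontrivial U] {A : U → U → Prop} (h : IsStrong A) {π : W → U}
    (hπ : Function.Surjective π) : IsStrong fun a b => A (π a) (π b) := by
  have trans : ∀ u w, Relation.TransGen A u w := by
    have : ∀ u w, u ≠ w → Relation.TransGen A u w := fun u w huw =>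
      (Relation.reflTransGen_iff_eq_or_transGen.1 (h u w)).resolve_left huw.symm
    intro u w
    by_cases huw : u = w
    · obtain ⟨z, hz⟩ := exists_ne u
      exact (this u z hz.symm).trans (this z w (huw ▸ hz))
    · exact this u w huw
  have lift : ∀ u w, Relation.TransGen A u w → ∀ a b, π a = u → π b = w →
      Relation.TransGen (fun a b => A (π a) (π b)) a b := by
    intro u w huw
    induction huw with
    | single h =>
      rintro a b rfl rfl
      exact .single h
    | @tail x _ _ h ih =>
      rintro a b rfl rfl
      obtain ⟨c, rfl⟩ := hπ x
      exact (ih a c rfl rfl).tail h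
  exact fun a b => (lift _ _ (trans _ _) a b rfl rfl).to_reflTransGen

/-- A good decomposition of `U` lifts to any digraph mapping onto it. -/
lemma GoodDecomp.comap {U W : Type*} [Nontrivial U] {T : U → U → Prop} {Q : W → W → Prop}
    (h : GoodDecomp T) {π : W → U} (hπ : Function.Surjective π)
    (hQ : ∀ a b, T (π a) (π b) → Q a b) : GoodDecomp Q := by
  obtain ⟨A, B, hA, hB, hAB, hAs, hBs⟩ := h
  exact ⟨_, _, fun a b h => hQ a b (hA _ _ h), fun a b h => hQ a b (hB _ _ h),
    fun a b => hAB _ _, hAs.comap hπ, hBs.comap hπ⟩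

/-- Doubling a vertex of `S4` gives a digraph with a good decomposition. -/
lemma goodDecomp_double_S4 :
    GoodDecomp fun x y : Fin 5 => S4Arc ((![0, 1, 2, 3, 0] : Fin 5 → Fin 4) x)
      ((![0, 1, 2, 3, 0] : Fin 5 → Fin 4) y) := by
  refine ⟨fun x y => hasArc 17213493256 x y = true, fun x y => hasArc 34428029188 x y = true,
    ?_, ?_, ?_, (cutStrong_of_strongCode (by decide +kernel)).isStrong,
    (cutStrong_of_strongCode (by decide +kernel)).isStrong⟩
  · unfold S4Arc
    decide +kernel
  · unfold S4Arc
    decide +kernel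
  · decide +kernel

lemma S4Arc_add : ∀ k i j : Fin 4, S4Arc (i + k) (j + k) ↔ S4Arc i j := by
  unfold S4Arc
  decide +kernel

lemma goodDecomp_comp_S4 {t : ℕ} {Vt : Fin t → Type*} [∀ i, Nonempty (Vt i)]
    {T : Fin t → Fin t → Prop} (H : ∀ i, Vt i → Vt i → Prop) (e : Fin 4 ≃ Fin t)
    (he : ∀ i j, S4Arc i j ↔ T (e i) (e j)) {i₀ : Fin t} {p q : Vt i₀} (hpq : p ≠ q) :
    GoodDecomp (CompArc T H) := by
  classical
  let f : Fin 4 ≃ Fin t := (Equiv.addRight (e.symm i₀)).trans e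
  have hf : ∀ i j, S4Arc i j ↔ T (f i) (f j) := fun i j => by
    rw [← S4Arc_add (e.symm i₀) i j, he]
    rfl
  have hf0 : f 0 = i₀ := by simp [f]
  let π : (Σ i, Vt i) → Fin 5 := fun a =>
    if a = ⟨i₀, p⟩ then 0 else if f.symm a.1 = 0 then 4 else (f.symm a.1).castSucc
  have hcast : ∀ k : Fin 4, (![0, 1, 2, 3, 0] : Fin 5 → Fin 4) k.castSucc = k := by decide
  have hπ : ∀ a, (![0, 1, 2, 3, 0] : Fin 5 → Fin 4) (π a) = f.symm a.1 := by
    intro a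
    simp only [π]
    split_ifs with h1 h2
    · subst h1
      simp [← hf0]
    · rw [h2]
      rfl
    · exact hcast _
  refine goodDecomp_double_S4.comap (π := π) (fun k => ?_) (fun a b hab => Or.inl ?_)
  · by_cases h0 : k = 0
    · exact ⟨⟨i₀, p⟩, by simp [π, h0]⟩
    · by_cases h4 : k = 4
      · exact ⟨⟨i₀, q⟩, by simp [π, h4, hpq.symm, ← hf0]⟩
      · obtain ⟨j, rfl⟩ : ∃ j : Fin 4, j.castSucc = k :=
          ⟨k.castPred (by simpa using h4), Fin.castSucc_castPred _ _⟩
        have hj : j ≠ 0 := by rintro rfl; simp at h0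
        refine ⟨⟨f j, Classical.arbitrary _⟩, ?_⟩
        have hne : f j ≠ i₀ := fun h => hj (f.injective (h.trans hf0.symm))
        have : (⟨f j, Classical.arbitrary _⟩ : Σ i, Vt i) ≠ ⟨i₀, p⟩ := fun h =>
          hne (congrArg Sigma.fst h)
        simp [π, this, hj]
  · rw [hπ, hπ, hf] at hab
    simpa using hab

lemma diso_of_subsingleton {t : ℕ} {Vt : Fin t → Type*} [∀ i, Nonempty (Vt i)]
    {T : Fin t → Fin t → Prop} {H : ∀ i, Vt i → Vt i → Prop} (hH : ∀ i, Irreflexive (H i))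
    (e : Fin 4 ≃ Fin t) (he : ∀ i j, S4Arc i j ↔ T (e i) (e j))
    (hs : ∀ i, ∀ p q : Vt i, p = q) : DIso (CompArc T H) S4Arc := by
  refine ⟨Equiv.ofBijective (fun a => e.symm a.1) ⟨?_, ?_⟩, ?_⟩
  · rintro ⟨i, x⟩ ⟨j, y⟩ h
    obtain rfl : i = j := e.symm.injective h
    rw [hs i x y]
  · exact fun k => ⟨⟨e k, Classical.arbitrary _⟩, by simp⟩
  · intro a b
    rw [he]
    change CompArc T H a b ↔ T (e (e.symm a.1)) (e (e.symm b.1))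
    rw [e.apply_symm_apply, e.apply_symm_apply]
    refine ⟨?_, Or.inl⟩
    rintro (h | ⟨h, h'⟩)
    · exact h
    · rw [hs b.1 (h ▸ a.2) b.2] at h'
      exact absurd h' (hH _ _)

end

theorem stmt_19 {t : ℕ} (ht : 2 ≤ t) {Vt : Fin t → Type*}
    [∀ i, Fintype (Vt i)] [∀ i, Nonempty (Vt i)]
    (T : Fin t → Fin t → Prop) (hT : Irreflexive T)
    (hTsc : Semicomplete T) (hT2 : TwoArcStrong T)
    (H : ∀ i, Vt i → Vt i → Prop) (hH : ∀ i, Irreflexive (H i))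
    (hniso : ¬ DIso (CompArc T H) S4Arc) :
    GoodDecomp (CompArc T H) := by
  have : Nontrivial (Fin t) := Fin.nontrivial_iff_two_le.2 ht
  rcases goodDecomp_or_diso ht hT hTsc hT2 with h | ⟨e, he⟩
  · exact h.comap (π := Sigma.fst) (fun i => ⟨⟨i, Classical.arbitrary _⟩, rfl⟩) fun _ _ => Or.inl
  · by_cases hs : ∀ i, ∀ p q : Vt i, p = q
    · exact absurd (diso_of_subsingleton hH e he hs) hniso
    · push Not at hs
      obtain ⟨i, p, q, hpq⟩ := hs
      exact goodDecomp_comp_S4 H e he hpq
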